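/- arXiv:2008.13148 — 4 statements merged into one kernel-verified Lean document; each statement's English description precedes it below -/
import Mathlib

section
/- Let m ≥ 0 be an integer. The function M attains its maximum over the square [0,1]×[0,1] on the diagonal: there exists t₀ ∈ [0,1] such that M(t,s) ≤ M(t₀,t₀) for all t,s ∈ [0,1]. -/
open MeasureTheory intervalIntegral

/-- Green function of the focal boundary value problem. -/
noncomputable def greenG (m : ℕ) (t s : ℝ) : ℝ :=
  (1 / ((Nat.factorial m : ℝ))^2) * ∫ τ in (0:ℝ)..(min s t), (t - τ)^m * (s - τ)^m

/-- The function M(t,s) = √(G(t,s)G(1,1)) − √(G(t,1)G(s,1)). -/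
noncomputable def funcM (m : ℕ) (t s : ℝ) : ℝ :=
  Real.sqrt (greenG m t s * greenG m 1 1) - Real.sqrt (greenG m t 1 * greenG m s 1)

/-- The normalised integral `∫₀¹ (1 - v)^m (1 - x v)^m dv`, with
`(m!)² G(t, s) = s^(m+1) t^m focalInt m (s / t)` for `s ≤ t`. -/
noncomputable def focalInt (m : ℕ) (x : ℝ) : ℝ :=
  ∫ v in (0:ℝ)..1, (1 - v) ^ m * (1 - x * v) ^ m

lemma hasDerivAt_focalInt (m : ℕ) (x : ℝ) :
    HasDerivAt (focalInt m)
      (∫ v in (0:ℝ)..1, (1 - v) ^ m * (m * (1 - x * v) ^ (m - 1) * -v)) x := by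
  obtain ⟨C, hC⟩ := ((isCompact_closedBall x 1).prod
    (isCompact_Icc (a := (0:ℝ)) (b := 1))).exists_bound_of_continuousOn
    (f := fun z : ℝ × ℝ => (1 - z.2) ^ m * (m * (1 - z.1 * z.2) ^ (m - 1) * -z.2))
    (by fun_prop)
  refine (intervalIntegral.hasDerivAt_integral_of_dominated_loc_of_deriv_le (bound := fun _ => C)
    (F := fun x v => (1 - v) ^ m * (1 - x * v) ^ m)
    (F' := fun x v => (1 - v) ^ m * (m * (1 - x * v) ^ (m - 1) * -v))
    (Metric.closedBall_mem_nhds x one_pos) ?_ ?_ ?_ ?_ ?_ ?_).2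
  · exact Filter.Eventually.of_forall fun y => (by fun_prop : Continuous _).aestronglyMeasurable
  · exact (by fun_prop : Continuous _).intervalIntegrable _ _
  · exact (by fun_prop : Continuous _).aestronglyMeasurable
  · refine Filter.Eventually.of_forall fun v hv y hy => hC (y, v) ⟨hy, ?_⟩
    rw [Set.uIoc_of_le zero_le_one] at hv
    exact ⟨hv.1.le, hv.2⟩
  · exact intervalIntegrable_const
  · refine Filter.Eventually.of_forall fun v _ y _ => ?_
    have h : HasDerivAt (fun y : ℝ => 1 - y * v) (-v) y := by
      simpa using ((hasDerivAt_id y).mul_const v).const_sub 1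
    simpa using (h.pow m).const_mul ((1 - v) ^ m)

lemma continuous_focalInt (m : ℕ) : Continuous (focalInt m) :=
  continuous_iff_continuousAt.2 fun x => (hasDerivAt_focalInt m x).continuousAt

lemma exists_hasDerivAt_focalInt (m : ℕ) (x : ℝ) :
    ∃ d, HasDerivAt (focalInt m) d x ∧
      x * (1 - x) * d + (m + 1 + m * x) * focalInt m x = 1 := by
  refine ⟨_, hasDerivAt_focalInt m x, ?_⟩
  have hder : ∀ v : ℝ, HasDerivAt (fun v => -((1 - v) ^ (m + 1) * (1 - x * v) ^ m))
      (x * (1 - x) * ((1 - v) ^ m * (m * (1 - x * v) ^ (m - 1) * -v))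
        + (m + 1 + m * x) * ((1 - v) ^ m * (1 - x * v) ^ m)) v := by
    intro v
    have h1 : HasDerivAt (fun v : ℝ => 1 - v) (-1) v := by
      simpa using (hasDerivAt_id v).const_sub 1
    have h2 : HasDerivAt (fun v : ℝ => 1 - x * v) (-x) v := by
      simpa using ((hasDerivAt_id v).const_mul x).const_sub 1
    refine ((h1.pow (m + 1)).mul (h2.pow m)).neg.congr_deriv ?_
    rcases m with _ | m
    · simp
    · push_cast
      simp only [Pi.pow_apply]
      ring
  have h := intervalIntegral.integral_eq_sub_of_hasDerivAt (a := 0) (b := 1) (fun v _ => hder v)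
    ((by fun_prop : Continuous _).intervalIntegrable _ _)
  rw [intervalIntegral.integral_add, intervalIntegral.integral_const_mul,
    intervalIntegral.integral_const_mul] at h
  · simpa [focalInt] using h
  · exact (by fun_prop : Continuous _).intervalIntegrable _ _
  · exact (by fun_prop : Continuous _).intervalIntegrable _ _

lemma focalInt_one (m : ℕ) : (2 * m + 1) * focalInt m 1 = 1 := by
  obtain ⟨d, -, h⟩ := exists_hasDerivAt_focalInt m 1
  linarith

lemma focalInt_pos (m : ℕ) {x : ℝ} (hx : x ≤ 1) : 0 < focalInt m x := by
  refine intervalIntegral.intervalIntegral_pos_of_pos_on ((by fun_prop : Continuous _).intervalIntegrable _ _)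
    (fun v hv => ?_) one_pos
  have h1 : 0 < 1 - v := by linarith [hv.2]
  have h2 : 0 < 1 - x * v := by nlinarith [hv.1]
  positivity

/-- Comparison principle for the first order linear equation satisfied by `focalInt m`. -/
lemma nonneg_of_linear_differential_inequality (m : ℕ) {D : ℝ → ℝ}
    (hc : ContinuousOn D (Set.Ico 0 1))
    (hD : ∀ x ∈ Set.Ioo (0:ℝ) 1, ∃ d, HasDerivAt D d x ∧
      0 ≤ x * (1 - x) * d + (m + 1 + m * x) * D x)
    {x : ℝ} (hx : x ∈ Set.Ioo (0:ℝ) 1) : 0 ≤ D x := by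
  have hmono : MonotoneOn (fun x => x ^ (m + 1) * D x / (1 - x) ^ (2 * m + 1)) (Set.Ico 0 1) := by
    have key : ∀ y ∈ Set.Ioo (0:ℝ) 1, ∃ d, 0 ≤ d ∧
        HasDerivAt (fun x => x ^ (m + 1) * D x / (1 - x) ^ (2 * m + 1)) d y := by
      intro y hy
      obtain ⟨d, hd, h0⟩ := hD y hy
      have h1 : 0 < 1 - y := by linarith [hy.2]
      have hs : HasDerivAt (fun v : ℝ => 1 - v) (-1) y := by
        simpa using (hasDerivAt_id y).const_sub 1
      refine ⟨y ^ m / (1 - y) ^ (2 * m + 2) * (y * (1 - y) * d + (m + 1 + m * y) * D y),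
        mul_nonneg (div_nonneg (pow_nonneg hy.1.le _) (by positivity)) h0, ?_⟩
      refine ((((hasDerivAt_id y).pow (m + 1)).mul hd).div (hs.pow (2 * m + 1))
        (pow_ne_zero _ h1.ne')).congr_deriv ?_
      simp only [Pi.pow_apply, id, Pi.mul_apply, Nat.add_sub_cancel]
      push_cast
      field_simp
      ring
    refine monotoneOn_of_deriv_nonneg (convex_Ico 0 1) ?_ ?_ ?_
    · refine ContinuousOn.div (by fun_prop) (by fun_prop) fun y hy => ?_
      exact pow_ne_zero _ (by linarith [hy.2])
    · intro y hy
      rw [interior_Ico] at hy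
      obtain ⟨d, -, h⟩ := key y hy
      exact h.differentiableAt.differentiableWithinAt
    · intro y hy
      rw [interior_Ico] at hy
      obtain ⟨d, h0, h⟩ := key y hy
      rwa [h.deriv]
  have h := hmono (Set.left_mem_Ico.2 one_pos) ⟨hx.1.le, hx.2⟩ hx.1.le
  have h1 : 0 < 1 - x := by linarith [hx.2]
  have h0 := hx.1
  simp only [ne_eq, Nat.add_eq_zero_iff, one_ne_zero, and_false, not_false_eq_true, zero_pow,
    zero_mul, zero_div] at h
  by_contra! hneg
  have : x ^ (m + 1) * D x / (1 - x) ^ (2 * m + 1) < 0 :=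
    div_neg_of_neg_of_pos (mul_neg_of_pos_of_neg (by positivity) hneg) (by positivity)
  linarith

lemma focalInt_le_div (m : ℕ) {N Q dN dQ : ℝ → ℝ} (hN : ∀ x, HasDerivAt N (dN x) x)
    (hQ : ∀ x, HasDerivAt Q (dQ x) x) (hpos : ∀ x ∈ Set.Ico (0:ℝ) 1, 0 < Q x)
    (h : ∀ x ∈ Set.Ioo (0:ℝ) 1, 0 ≤ x * (1 - x) * (dN x * Q x - N x * dQ x)
      + (m + 1 + m * x) * N x * Q x - Q x ^ 2) {x : ℝ} (hx : x ∈ Set.Ioo (0:ℝ) 1) :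
    focalInt m x ≤ N x / Q x := by
  have hcN : Continuous N := continuous_iff_continuousAt.2 fun x => (hN x).continuousAt
  have hcQ : Continuous Q := continuous_iff_continuousAt.2 fun x => (hQ x).continuousAt
  refine sub_nonneg.1 (nonneg_of_linear_differential_inequality m
    (D := fun x => N x / Q x - focalInt m x) ?_ ?_ hx)
  · exact (hcN.continuousOn.div hcQ.continuousOn fun y hy => (hpos y hy).ne').sub
      (continuous_focalInt m).continuousOn
  · intro y hy
    have hq := hpos y ⟨hy.1.le, hy.2⟩
    obtain ⟨d, hd, hode⟩ := exists_hasDerivAt_focalInt m y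
    refine ⟨_, ((hN y).div (hQ y) hq.ne').sub hd, ?_⟩
    have := div_nonneg (h y hy) (sq_nonneg (Q y))
    refine this.trans_eq ?_
    field_simp
    linear_combination (Q y) ^ 2 * hode

lemma div_le_focalInt (m : ℕ) {N Q dN dQ : ℝ → ℝ} (hN : ∀ x, HasDerivAt N (dN x) x)
    (hQ : ∀ x, HasDerivAt Q (dQ x) x) (hpos : ∀ x ∈ Set.Ico (0:ℝ) 1, 0 < Q x)
    (h : ∀ x ∈ Set.Ioo (0:ℝ) 1, x * (1 - x) * (dN x * Q x - N x * dQ x)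
      + (m + 1 + m * x) * N x * Q x - Q x ^ 2 ≤ 0) {x : ℝ} (hx : x ∈ Set.Ioo (0:ℝ) 1) :
    N x / Q x ≤ focalInt m x := by
  have hcN : Continuous N := continuous_iff_continuousAt.2 fun x => (hN x).continuousAt
  have hcQ : Continuous Q := continuous_iff_continuousAt.2 fun x => (hQ x).continuousAt
  refine sub_nonneg.1 (nonneg_of_linear_differential_inequality m
    (D := fun x => focalInt m x - N x / Q x) ?_ ?_ hx)
  · exact (continuous_focalInt m).continuousOn.sub
      (hcN.continuousOn.div hcQ.continuousOn fun y hy => (hpos y hy).ne')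
  · intro y hy
    have hq := hpos y ⟨hy.1.le, hy.2⟩
    obtain ⟨d, hd, hode⟩ := exists_hasDerivAt_focalInt m y
    refine ⟨_, hd.sub ((hN y).div (hQ y) hq.ne'), ?_⟩
    have := div_nonneg (neg_nonneg.2 (h y hy)) (sq_nonneg (Q y))
    refine this.trans_eq ?_
    field_simp
    linear_combination -(Q y) ^ 2 * hode

/-- Twice the logarithmic derivative of `√x * focalInt m x` with respect to `log x`. -/
noncomputable def focalSlope (m : ℕ) (x : ℝ) : ℝ :=
  (2 / focalInt m x - (2 * m + 1) * (1 + x)) / (1 - x)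

lemma le_focalSlope {m : ℕ} (hm : 1 ≤ m) {x : ℝ} (hx : x ∈ Set.Ioo (0:ℝ) 1) :
    (2 * m + 1) * ((1 - x) / (1 + x)) / (2 * m - 1 + 2 * ((1 - x) / (1 + x)))
      ≤ focalSlope m x := by
  have hm' : (1:ℝ) ≤ m := by exact_mod_cast hm
  obtain ⟨n, hn⟩ : ∃ n : ℝ, (m:ℝ) = n + 1 := ⟨m - 1, by ring⟩
  have hn0 : 0 ≤ n := by linarith
  have hQ0 : ∀ y ∈ Set.Ico (0:ℝ) 1,
      0 < (2 * m + 1) * (2 * m + 2 + (4 * m - 4) * y + (2 * m - 2) * y ^ 2) := by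
    intro y hy
    have := hy.1
    rw [hn]
    ring_nf
    positivity
  have h := focalInt_le_div m (N := fun x => 2 * (2 * m + 1 + (2 * m - 3) * x))
    (dN := fun _ => 2 * (2 * m - 3))
    (Q := fun x => (2 * m + 1) * (2 * m + 2 + (4 * m - 4) * x + (2 * m - 2) * x ^ 2))
    (dQ := fun x => (2 * m + 1) * ((4 * m - 4) + (2 * m - 2) * (2 * x)))
    (fun y => by
      simpa using (((hasDerivAt_id y).const_mul (2 * m - 3 : ℝ)).const_add
        (2 * m + 1 : ℝ)).const_mul 2)
    (fun y => by
      simpa using ((((hasDerivAt_id y).const_mul (4 * m - 4 : ℝ)).const_add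
        (2 * m + 2 : ℝ)).add ((hasDerivAt_pow 2 y).const_mul (2 * m - 2 : ℝ))).const_mul
        (2 * m + 1 : ℝ))
    hQ0
    (fun y hy => by
      have h1 : 0 ≤ 1 - y := by linarith [hy.2]
      have : 0 ≤ (2 * m + 1) * (8 * n) * y * (1 - y) ^ 3 := by
        have := hy.1
        positivity
      refine this.trans_eq ?_
      rw [hn]
      ring) hx
  have hx0 := hx.1
  have hx1 : 0 < 1 - x := by linarith [hx.2]
  have hJ := focalInt_pos m hx.2.le
  have hQ := hQ0 x ⟨hx0.le, hx.2⟩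
  have hB : 0 < 2 * (m:ℝ) + 1 + (2 * m - 3) * x := by nlinarith
  have h2 : (2 * m + 1) * (2 * m + 2 + (4 * m - 4) * x + (2 * m - 2) * x ^ 2)
      / (2 * m + 1 + (2 * m - 3) * x) ≤ 2 / focalInt m x := by
    rw [le_div_iff₀ (by positivity)] at h
    rw [div_le_div_iff₀ hB hJ]
    linarith
  have hD : 0 < 2 * (m:ℝ) - 1 + 2 * ((1 - x) / (1 + x)) := by
    have : 0 < (1 - x) / (1 + x) := by positivity
    linarith
  rw [focalSlope, le_div_iff₀ hx1]
  refine le_trans (le_of_eq ?_) (sub_le_sub_right h2 _)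
  have hD' : 2 * (m:ℝ) - 1 + 2 * ((1 - x) / (1 + x)) =
      (2 * m + 1 + (2 * m - 3) * x) / (1 + x) := by
    field_simp
    ring
  have hBne := hB.ne'
  rw [hD']
  generalize hBx : 2 * (m:ℝ) + 1 + (2 * m - 3) * x = B at *
  field_simp
  rw [← hBx]
  ring

lemma focalSlope_nonneg {m : ℕ} (hm : 1 ≤ m) {x : ℝ} (hx : x ∈ Set.Ioo (0:ℝ) 1) :
    0 ≤ focalSlope m x := by
  refine le_trans ?_ (le_focalSlope hm hx)
  have hm' : (1:ℝ) ≤ m := by exact_mod_cast hm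
  have : 0 ≤ (1 - x) / (1 + x) := div_nonneg (by linarith [hx.2]) (by linarith [hx.1])
  exact div_nonneg (by positivity) (by linarith)

lemma focalSlope_le_of_div_le (m : ℕ) {x N Q : ℝ} (hx : x < 1) (hN : 0 < N) (hQ : 0 < Q)
    (h : N / Q ≤ focalInt m x) :
    focalSlope m x ≤ (2 * Q / N - (2 * m + 1) * (1 + x)) / (1 - x) := by
  have h1 : 0 < 1 - x := by linarith
  refine div_le_div_of_nonneg_right (sub_le_sub_right ?_ _) h1.le
  rw [div_le_iff₀ hQ] at h
  rw [div_le_div_iff₀ (focalInt_pos m hx.le) hN]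
  linarith

lemma focalSlope_le_one (m : ℕ) {x : ℝ} (hx : x ∈ Set.Ioo (0:ℝ) 1) :
    focalSlope m x ≤ 1 := by
  have h := div_le_focalInt m (N := fun _ => 2) (dN := fun _ => 0)
    (Q := fun x => 2 * m + 2 + 2 * m * x) (dQ := fun _ => 2 * m)
    (fun y => hasDerivAt_const _ _)
    (fun y => by simpa using ((hasDerivAt_id y).const_mul (2 * m : ℝ)).const_add (2 * m + 2 : ℝ))
    (fun y hy => by
      have := hy.1
      positivity)
    (fun y hy => by
      have h1 : 0 ≤ 1 - y := by linarith [hy.2]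
      have : 0 ≤ 4 * m * y * (1 - y) := by
        have := hy.1
        positivity
      linarith) hx
  have hx0 := hx.1
  have hx1 : 1 - x ≠ 0 := by linarith [hx.2]
  refine (focalSlope_le_of_div_le m hx.2 two_pos (by positivity) h).trans_eq ?_
  field_simp
  ring

lemma focalSlope_le {m : ℕ} (hm : 1 ≤ m) {x : ℝ} (hx : x ∈ Set.Ioo (0:ℝ) 1) :
    focalSlope m x ≤ (1 - x) / (1 + x) * (1 + 8 * x / ((2 * m - 1) * (1 + x) ^ 2)) := by
  have hm' : (1:ℝ) ≤ m := by exact_mod_cast hm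
  have hq : 0 < 2 * (m:ℝ) - 1 := by linarith
  have hder (y : ℝ) (n : ℕ) : HasDerivAt (fun x : ℝ => (1 + x) ^ n) (n * (1 + y) ^ (n - 1)) y := by
    exact (((hasDerivAt_id y).const_add 1).pow n).congr_deriv (by simp)
  have hQ0 : ∀ y ∈ Set.Ico (0:ℝ) 1, 0 < (2 * m + 1) * (2 * m - 1) * (1 + y) ^ 4
      + (1 - y) ^ 2 * ((2 * m - 1) * (1 + y) ^ 2 + 8 * y) := by
    intro y hy
    have := hy.1
    positivity
  have h := div_le_focalInt m (N := fun x => 2 * (2 * m - 1) * (1 + x) ^ 3)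
    (dN := fun x => 2 * (2 * m - 1) * (3 * (1 + x) ^ 2))
    (Q := fun x => (2 * m + 1) * (2 * m - 1) * (1 + x) ^ 4
      + (1 - x) ^ 2 * ((2 * m - 1) * (1 + x) ^ 2 + 8 * x))
    (dQ := fun x => (2 * m + 1) * (2 * m - 1) * (4 * (1 + x) ^ 3)
      + (-(2 * (1 - x)) * ((2 * m - 1) * (1 + x) ^ 2 + 8 * x)
        + (1 - x) ^ 2 * ((2 * m - 1) * (2 * (1 + x)) + 8)))
    (fun y => by simpa using (hder y 3).const_mul (2 * (2 * m - 1) : ℝ))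
    (fun y => by
      have h1 : HasDerivAt (fun x : ℝ => (1 - x) ^ 2) (-(2 * (1 - y))) y := by
        exact (((hasDerivAt_id y).const_sub 1).pow 2).congr_deriv (by simp)
      have h2 : HasDerivAt (fun x : ℝ => (2 * m - 1) * (1 + x) ^ 2 + 8 * x)
          ((2 * m - 1) * (2 * (1 + y)) + 8) y := by
        exact (((hder y 2).const_mul (2 * m - 1 : ℝ)).add
          ((hasDerivAt_id y).const_mul 8)).congr_deriv (by simp)
      exact (((hder y 4).const_mul ((2 * m + 1) * (2 * m - 1) : ℝ)).add
        (h1.mul h2)).congr_deriv (by simp))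
    hQ0
    (fun y hy => by
      have h1 : 0 ≤ 1 - y := by linarith [hy.2]
      have : 0 ≤ 4 * y * (1 - y) ^ 4 * (10 * (2 * m - 1) * (1 + y) ^ 2 + 16 * y) := by
        have := hy.1
        positivity
      refine le_trans (le_of_eq ?_) (neg_nonpos.2 this)
      ring) hx
  have hx0 := hx.1
  have hx1 : 1 - x ≠ 0 := by linarith [hx.2]
  refine (focalSlope_le_of_div_le m hx.2 (by positivity) (hQ0 x ⟨hx0.le, hx.2⟩) h).trans_eq ?_
  field_simp
  ring

lemma hasDerivAt_focalSlope (m : ℕ) {x : ℝ} (hx : x ∈ Set.Ioo (0:ℝ) 1) :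
    HasDerivAt (focalSlope m)
      (-(focalSlope m x ^ 2 + 2 * m * ((1 + x) / (1 - x)) * focalSlope m x - (2 * m + 1))
        / (2 * x)) x := by
  obtain ⟨d, hd, hode⟩ := exists_hasDerivAt_focalInt m x
  have hx0 := hx.1
  have hx1 : 1 - x ≠ 0 := by linarith [hx.2]
  have hJ := (focalInt_pos m hx.2.le).ne'
  have h1 : HasDerivAt (fun v : ℝ => 1 - v) (-1) x := by
    simpa using (hasDerivAt_id x).const_sub 1
  have h2 : HasDerivAt (fun v : ℝ => (2 * m + 1) * (1 + v)) (2 * m + 1 : ℝ) x := by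
    simpa using ((hasDerivAt_id x).const_add 1).const_mul (2 * m + 1 : ℝ)
  refine ((((hasDerivAt_const x (2:ℝ)).div hd hJ).sub h2).div h1 hx1).congr_deriv ?_
  have hd' : d = (1 - (m + 1 + m * x) * focalInt m x) / (x * (1 - x)) := by
    rw [eq_div_iff (by positivity)]
    linarith
  simp only [focalSlope, hd', Pi.div_apply, Pi.sub_apply]
  field_simp
  ring

lemma antitoneOn_sub_focalSlope {m : ℕ} (hm : 1 ≤ m) :
    AntitoneOn (fun x => 4 * m / (2 * m - 1) * ((1 - x) / (1 + x)) - focalSlope m x)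
      (Set.Ioo 0 1) := by
  have hm' : (1:ℝ) ≤ m := by exact_mod_cast hm
  have hq : 0 < 2 * (m:ℝ) - 1 := by linarith
  have key : ∀ x ∈ Set.Ioo (0:ℝ) 1, ∃ d ≤ 0, HasDerivAt
      (fun x => 4 * m / (2 * m - 1) * ((1 - x) / (1 + x)) - focalSlope m x) d x := by
    intro x hx
    have hx0 := hx.1
    have hx1 : 0 < 1 - x := by linarith [hx.2]
    have h1 : HasDerivAt (fun v : ℝ => 1 - v) (-1) x := by
      simpa using (hasDerivAt_id x).const_sub 1
    have h2 : HasDerivAt (fun v : ℝ => 1 + v) 1 x := by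
      simpa using (hasDerivAt_id x).const_add 1
    refine ⟨_, ?_, ((h1.div h2 (by positivity)).const_mul (4 * m / (2 * m - 1) : ℝ)).sub
      (hasDerivAt_focalSlope m hx)⟩
    have h0 := focalSlope_nonneg hm hx
    have hsq : focalSlope m x ^ 2 ≤ 1 := by nlinarith [focalSlope_le_one m hx]
    have hlin : 2 * m * ((1 + x) / (1 - x)) * focalSlope m x ≤
        2 * m * (1 + 8 * x / ((2 * m - 1) * (1 + x) ^ 2)) := by
      refine (mul_le_mul_of_nonneg_left (focalSlope_le hm hx) (by positivity)).trans_eq ?_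
      field_simp
    have hle : (focalSlope m x ^ 2 + 2 * m * ((1 + x) / (1 - x)) * focalSlope m x - (2 * m + 1))
        / (2 * x) ≤ 2 * m * (8 * x / ((2 * m - 1) * (1 + x) ^ 2)) / (2 * x) :=
      div_le_div_of_nonneg_right (by linarith) (by positivity)
    have heq : 2 * m * (8 * x / ((2 * m - 1) * (1 + x) ^ 2)) / (2 * x) +
        4 * m / (2 * m - 1) * ((-1 * (1 + x) - (1 - x) * 1) / (1 + x) ^ 2) = 0 := by
      field_simp
      ring
    rw [neg_div]
    linarith
  refine antitoneOn_of_deriv_nonpos (convex_Ioo 0 1) ?_ ?_ ?_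
  · intro x hx
    obtain ⟨d, -, h⟩ := key x hx
    exact h.continuousAt.continuousWithinAt
  · intro x hx
    rw [interior_Ioo] at hx
    obtain ⟨d, -, h⟩ := key x hx
    exact h.differentiableAt.differentiableWithinAt
  · intro x hx
    rw [interior_Ioo] at hx
    obtain ⟨d, h0, h⟩ := key x hx
    rwa [h.deriv]

lemma focalSlope_mul_sub_le {m : ℕ} (hm : 1 ≤ m) {x y : ℝ} (hx : x ∈ Set.Ioo (0:ℝ) 1)
    (hy : y ∈ Set.Ioo (0:ℝ) 1) :
    focalSlope m (x * y) - focalSlope m x ≤ 2 * focalSlope m y := by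
  have hm' : (1:ℝ) ≤ m := by exact_mod_cast hm
  have hq : 0 < 2 * (m:ℝ) - 1 := by linarith
  obtain ⟨hx0, hx1⟩ := hx
  obtain ⟨hy0, hy1⟩ := hy
  have hxy : x * y ∈ Set.Ioo (0:ℝ) 1 := ⟨by positivity, by nlinarith⟩
  have hanti := antitoneOn_sub_focalSlope hm hxy ⟨hx0, hx1⟩ (by nlinarith)
  simp only at hanti
  have htanh : (1 - x * y) / (1 + x * y) - (1 - x) / (1 + x) ≤ (1 - y) / (1 + y) := by
    rw [div_sub_div _ _ (by positivity) (by positivity),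
      div_le_div_iff₀ (by positivity) (by positivity)]
    have : 0 ≤ (1 - y) * ((1 - x) * (1 - x * y)) :=
      mul_nonneg (by linarith) (mul_nonneg (by linarith) (by linarith [hxy.2]))
    nlinarith
  have hlip : focalSlope m (x * y) - focalSlope m x ≤
      4 * m / (2 * m - 1) * ((1 - y) / (1 + y)) := by
    have := mul_le_mul_of_nonneg_left htanh (by positivity : 0 ≤ 4 * (m:ℝ) / (2 * m - 1))
    linarith
  have hone : focalSlope m (x * y) - focalSlope m x ≤ 1 := by
    linarith [focalSlope_le_one m hxy, focalSlope_nonneg hm ⟨hx0, hx1⟩]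
  have hlow := le_focalSlope hm ⟨hy0, hy1⟩
  have hT : 0 < (1 - y) / (1 + y) := div_pos (by linarith) (by linarith)
  generalize (1 - y) / (1 + y) = T at *
  rcases le_total (4 * m / (2 * m - 1) * T) 1 with h | h
  · have : 4 * m / (2 * m - 1) * T ≤ 2 * ((2 * m + 1) * T / (2 * m - 1 + 2 * T)) := by
      rw [div_mul_eq_mul_div, div_le_one hq] at h
      rw [div_mul_eq_mul_div, mul_div_assoc', div_le_div_iff₀ hq (by positivity)]
      nlinarith
    linarith
  · have : 1 ≤ 2 * ((2 * m + 1) * T / (2 * m - 1 + 2 * T)) := by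
      rw [div_mul_eq_mul_div, one_le_div hq] at h
      rw [mul_div_assoc', one_le_div (by positivity)]
      linarith
    linarith

/-- The cosine of the angle between the representers of `t` and `s` for the kernel `greenG m`,
as a function of `s / t`. -/
noncomputable def focalCorr (m : ℕ) (x : ℝ) : ℝ :=
  √x * ((2 * m + 1) * focalInt m x)

lemma continuous_focalCorr (m : ℕ) : Continuous (focalCorr m) :=
  Real.continuous_sqrt.mul (continuous_const.mul (continuous_focalInt m))

lemma focalCorr_pos (m : ℕ) {x : ℝ} (hx : x ∈ Set.Ioc (0:ℝ) 1) : 0 < focalCorr m x :=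
  mul_pos (Real.sqrt_pos.2 hx.1) (mul_pos (by positivity) (focalInt_pos m hx.2))

lemma focalCorr_one (m : ℕ) : focalCorr m 1 = 1 := by
  rw [focalCorr, focalInt_one, Real.sqrt_one, one_mul]

lemma focalCorr_zero_left (x : ℝ) : focalCorr 0 x = √x := by
  simp [focalCorr, focalInt]

lemma continuousOn_log_focalCorr (m : ℕ) :
    ContinuousOn (fun x => Real.log (focalCorr m x)) (Set.Ioc 0 1) :=
  (continuous_focalCorr m).continuousOn.log fun _ hx => (focalCorr_pos m hx).ne'

lemma hasDerivAt_log_focalCorr (m : ℕ) {x : ℝ} (hx : x ∈ Set.Ioo (0:ℝ) 1) :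
    HasDerivAt (fun x => Real.log (focalCorr m x)) (focalSlope m x / (2 * x)) x := by
  obtain ⟨d, hd, hode⟩ := exists_hasDerivAt_focalInt m x
  have hx0 := hx.1
  have hx1 : 1 - x ≠ 0 := by linarith [hx.2]
  have hJ := (focalInt_pos m hx.2.le).ne'
  have hs := Real.sq_sqrt hx0.le
  have hs0 := (Real.sqrt_pos.2 hx0).ne'
  refine (((Real.hasDerivAt_sqrt hx0.ne').mul (hd.const_mul (2 * m + 1 : ℝ))).log
    (focalCorr_pos m ⟨hx0, hx.2.le⟩).ne').congr_deriv ?_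
  have hd' : d = (1 - (m + 1 + m * x) * focalInt m x) / (x * (1 - x)) := by
    rw [eq_div_iff (by positivity)]
    linarith
  simp only [focalSlope, hd', Pi.mul_apply]
  field_simp
  rw [hs]
  ring

lemma focalCorr_le_one (m : ℕ) {x : ℝ} (hx : x ∈ Set.Ioc (0:ℝ) 1) : focalCorr m x ≤ 1 := by
  rcases Nat.eq_zero_or_pos m with rfl | hm
  · rw [focalCorr_zero_left]
    exact Real.sqrt_le_one.2 hx.2
  have hmono : MonotoneOn (fun x => Real.log (focalCorr m x)) (Set.Ioc 0 1) := by
    refine monotoneOn_of_deriv_nonneg (convex_Ioc 0 1) (continuousOn_log_focalCorr m) ?_ ?_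
    · intro y hy
      rw [interior_Ioc] at hy
      exact (hasDerivAt_log_focalCorr m hy).differentiableAt.differentiableWithinAt
    · intro y hy
      rw [interior_Ioc] at hy
      rw [(hasDerivAt_log_focalCorr m hy).deriv]
      exact div_nonneg (focalSlope_nonneg hm hy) (by linarith [hy.1])
  have h := hmono hx (Set.right_mem_Ioc.2 one_pos) hx.2
  simp only [focalCorr_one, Real.log_one] at h
  exact (Real.log_nonpos_iff (focalCorr_pos m hx).le).1 h

lemma focalCorr_sq_mul_sq_le (m : ℕ) {r y : ℝ} (hr : 0 < r) (hry : r ≤ y) (hy : y ≤ 1) :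
    focalCorr m (y ^ 2) * focalCorr m r ^ 2 ≤ focalCorr m (r / y) * focalCorr m (r * y) := by
  have hmem : ∀ z ∈ Set.Icc r 1, r / z ∈ Set.Ioc (0:ℝ) 1 ∧ r * z ∈ Set.Ioc (0:ℝ) 1 ∧
      z ^ 2 ∈ Set.Ioc (0:ℝ) 1 := by
    rintro z ⟨hz, hz1⟩
    have hz0 : 0 < z := hr.trans_le hz
    refine ⟨⟨by positivity, (div_le_one hz0).2 hz⟩, ⟨by positivity, by nlinarith⟩,
      by positivity, by nlinarith⟩
  have hy0 : 0 < y := hr.trans_le hry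
  rcases Nat.eq_zero_or_pos m with rfl | hm
  · simp only [focalCorr_zero_left]
    rw [← Real.sqrt_mul (by positivity), Real.sq_sqrt hr.le, Real.sqrt_sq hy0.le,
      show r / y * (r * y) = r ^ 2 by field_simp, Real.sqrt_sq hr.le]
    nlinarith
  let Ψ : ℝ → ℝ := fun z => Real.log (focalCorr m (r / z)) + Real.log (focalCorr m (r * z))
    - Real.log (focalCorr m (z ^ 2))
  have key : ∀ z ∈ Set.Ioo r 1, ∃ d ≤ 0, HasDerivAt Ψ d z := by
    rintro z ⟨hz, hz1⟩
    have hz0 : 0 < z := hr.trans hz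
    have h1 : r / z ∈ Set.Ioo (0:ℝ) 1 := ⟨by positivity, (div_lt_one hz0).2 hz⟩
    have h2 : r * z ∈ Set.Ioo (0:ℝ) 1 := ⟨by positivity, by nlinarith⟩
    have h3 : z ^ 2 ∈ Set.Ioo (0:ℝ) 1 := ⟨by positivity, by nlinarith⟩
    have hdiv : HasDerivAt (fun z => r / z) (-r / z ^ 2) z :=
      ((hasDerivAt_const z r).div (hasDerivAt_id z) hz0.ne').congr_deriv (by simp)
    have hmul : HasDerivAt (fun z => r * z) r z := by
      simpa using (hasDerivAt_id z).const_mul r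
    have hpow : HasDerivAt (fun z : ℝ => z ^ 2) (2 * z) z := by
      simpa using hasDerivAt_pow 2 z
    have hd := (((hasDerivAt_log_focalCorr m h1).comp z hdiv).add
      ((hasDerivAt_log_focalCorr m h2).comp z hmul)).sub
      (HasDerivAt.comp (h := fun z : ℝ => z ^ 2) z (hasDerivAt_log_focalCorr m h3) hpow)
    refine ⟨_, ?_, hd⟩
    have hle := focalSlope_mul_sub_le hm h1 h3
    rw [show r / z * z ^ 2 = r * z by field_simp] at hle
    have : 0 ≤ (2 * focalSlope m (z ^ 2) - (focalSlope m (r * z) - focalSlope m (r / z)))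
        / (2 * z) := div_nonneg (by linarith) (by linarith)
    refine le_trans (le_of_eq ?_) (neg_nonpos.2 this)
    field_simp
    ring
  have hanti : AntitoneOn Ψ (Set.Icc r 1) := by
    refine antitoneOn_of_deriv_nonpos (convex_Icc r 1) ?_ ?_ ?_
    · refine ((ContinuousOn.comp (continuousOn_log_focalCorr m) ?_ fun z hz => (hmem z hz).1).add
        (ContinuousOn.comp (continuousOn_log_focalCorr m) ?_ fun z hz => (hmem z hz).2.1)).sub
        (ContinuousOn.comp (continuousOn_log_focalCorr m) ?_ fun z hz => (hmem z hz).2.2)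
      · exact continuousOn_const.div continuousOn_id fun z hz => (hr.trans_le hz.1).ne'
      · fun_prop
      · fun_prop
    · intro z hz
      rw [interior_Icc] at hz
      obtain ⟨d, -, h⟩ := key z hz
      exact h.differentiableAt.differentiableWithinAt
    · intro z hz
      rw [interior_Icc] at hz
      obtain ⟨d, h0, h⟩ := key z hz
      rwa [h.deriv]
  have h := hanti ⟨hry, hy⟩ ⟨hry.trans hy, le_rfl⟩ hy
  obtain ⟨h1, h2, h3⟩ := hmem y ⟨hry, hy⟩
  have p0 := focalCorr_pos m ⟨hr, hry.trans hy⟩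
  have p1 := focalCorr_pos m h1
  have p2 := focalCorr_pos m h2
  have p3 := focalCorr_pos m h3
  simp only [Ψ, div_one, mul_one, one_pow, focalCorr_one, Real.log_one, sub_zero] at h
  rw [← Real.log_le_log_iff (by positivity) (by positivity),
    Real.log_mul p3.ne' (by positivity), Real.log_mul p1.ne' p2.ne', Real.log_pow]
  push_cast
  linarith

lemma sqrt_focalCorr_sub_le (m : ℕ) {t s : ℝ} (hs : 0 < s) (hst : s ≤ t) (ht : t ≤ 1) :
    √(focalCorr m (s / t)) - √(focalCorr m t * focalCorr m s) ≤ 1 - focalCorr m √(t * s) := by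
  have ht0 : 0 < t := hs.trans_le hst
  have hr : 0 < √(t * s) := Real.sqrt_pos.2 (by positivity)
  have hst1 : s / t ≤ 1 := (div_le_one ht0).2 hst
  have hr1 : √(t * s) ≤ 1 := Real.sqrt_le_one.2 (by nlinarith)
  have hry : √(t * s) ≤ √(s / t) := by
    refine Real.sqrt_le_sqrt ?_
    rw [le_div_iff₀ ht0]
    nlinarith [mul_pos ht0 hs]
  have h := focalCorr_sq_mul_sq_le m hr hry (Real.sqrt_le_one.2 hst1)
  rw [← Real.sqrt_div (by positivity), ← Real.sqrt_mul (by positivity),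
    Real.sq_sqrt (by positivity), show t * s / (s / t) = t ^ 2 by field_simp,
    show t * s * (s / t) = s ^ 2 by field_simp, Real.sqrt_sq ht0.le, Real.sqrt_sq hs.le] at h
  have hp := focalCorr_pos m ⟨by positivity, hst1⟩
  have hb := focalCorr_pos m ⟨hr, hr1⟩
  have hsqrt := Real.sqrt_le_sqrt h
  rw [Real.sqrt_mul hp.le, Real.sqrt_sq hb.le] at hsqrt
  have ha1 : √(focalCorr m (s / t)) ≤ 1 :=
    Real.sqrt_le_one.2 (focalCorr_le_one m ⟨by positivity, hst1⟩)
  have hb1 := focalCorr_le_one m ⟨hr, hr1⟩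
  nlinarith

lemma greenG_comm (m : ℕ) (t s : ℝ) : greenG m t s = greenG m s t := by
  simp only [greenG, min_comm s t, mul_comm]

lemma funcM_comm (m : ℕ) (t s : ℝ) : funcM m t s = funcM m s t := by
  rw [funcM, funcM, greenG_comm m t s, mul_comm (greenG m t 1)]

lemma greenG_eq_focalInt (m : ℕ) {t s : ℝ} (ht : 0 < t) (hst : s ≤ t) :
    greenG m t s =
      1 / (Nat.factorial m : ℝ) ^ 2 * (s ^ (m + 1) * t ^ m * focalInt m (s / t)) := by
  have h := intervalIntegral.mul_integral_comp_mul_left (a := 0) (b := 1)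
    (f := fun τ => (t - τ) ^ m * (s - τ) ^ m) s
  rw [mul_zero, mul_one] at h
  rw [greenG, min_eq_left hst, ← h, focalInt]
  congr 1
  rw [← intervalIntegral.integral_const_mul, ← intervalIntegral.integral_const_mul]
  refine intervalIntegral.integral_congr fun v _ => ?_
  have h1 : t - s * v = t * (1 - s / t * v) := by field_simp
  have h2 : s - s * v = s * (1 - v) := by ring
  simp only [h1, h2, mul_pow]
  ring

lemma greenG_zero_right (m : ℕ) {t : ℝ} (ht : 0 ≤ t) : greenG m t 0 = 0 := by
  simp [greenG, ht]

lemma greenG_eq_focalCorr (m : ℕ) {t s : ℝ} (hs : 0 < s) (hst : s ≤ t) :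
    greenG m t s = 1 / ((Nat.factorial m : ℝ) ^ 2 * (2 * m + 1)) *
      (√(t * s) ^ (2 * m + 1) * focalCorr m (s / t)) := by
  have ht : 0 < t := hs.trans_le hst
  have h : √(t * s) ^ (2 * m + 1) * √(s / t) = s ^ (m + 1) * t ^ m := by
    rw [pow_succ, mul_assoc, ← Real.sqrt_mul (by positivity),
      show t * s * (s / t) = s ^ 2 by field_simp, Real.sqrt_sq hs.le, pow_mul,
      Real.sq_sqrt (by positivity)]
    ring
  rw [greenG_eq_focalInt m ht hst, focalCorr, ← h]
  field_simp

lemma funcM_eq_focalCorr (m : ℕ) {t s : ℝ} (hs : 0 < s) (hst : s ≤ t) (ht : t ≤ 1) :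
    funcM m t s = 1 / ((Nat.factorial m : ℝ) ^ 2 * (2 * m + 1)) * √(√(t * s) ^ (2 * m + 1)) *
      (√(focalCorr m (s / t)) - √(focalCorr m t * focalCorr m s)) := by
  have ht0 : 0 < t := hs.trans_le hst
  have hc : 0 < 1 / ((Nat.factorial m : ℝ) ^ 2 * (2 * m + 1)) := by positivity
  rw [funcM, greenG_eq_focalCorr m hs hst, greenG_eq_focalCorr m one_pos le_rfl,
    greenG_comm m t 1, greenG_comm m s 1, greenG_eq_focalCorr m ht0 ht,
    greenG_eq_focalCorr m hs (hst.trans ht)]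
  generalize 1 / ((Nat.factorial m : ℝ) ^ 2 * (2 * m + 1)) = c at *
  simp only [one_mul, div_one, focalCorr_one, Real.sqrt_one, one_pow, mul_one]
  have hsplit : ∀ w, √(c ^ 2 * (√(t * s) ^ (2 * m + 1) * w)) =
      c * √(√(t * s) ^ (2 * m + 1)) * √w := fun w => by
    rw [Real.sqrt_mul (by positivity), Real.sqrt_sq hc.le, Real.sqrt_mul (by positivity), mul_assoc]
  rw [mul_sub, ← hsplit, ← hsplit, Real.sqrt_mul ht0.le, mul_pow]
  congr 2 <;> ring

lemma funcM_le_funcM_sqrt_mul (m : ℕ) {t s : ℝ} (hs : 0 < s) (hst : s ≤ t) (ht : t ≤ 1) :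
    funcM m t s ≤ funcM m √(t * s) √(t * s) := by
  have ht0 : 0 < t := hs.trans_le hst
  have hr : 0 < √(t * s) := Real.sqrt_pos.2 (by positivity)
  have hr1 : √(t * s) ≤ 1 := Real.sqrt_le_one.2 (by nlinarith)
  rw [funcM_eq_focalCorr m hs hst ht, funcM_eq_focalCorr m hr le_rfl hr1,
    Real.sqrt_mul_self hr.le, Real.sqrt_mul_self (focalCorr_pos m ⟨hr, hr1⟩).le,
    div_self hr.ne', focalCorr_one, Real.sqrt_one]
  exact mul_le_mul_of_nonneg_left (sqrt_focalCorr_sub_le m hs hst ht) (by positivity)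

lemma continuousOn_funcM_diag (m : ℕ) :
    ContinuousOn (fun t => funcM m t t) (Set.Icc 0 1) := by
  have hdiag : ContinuousOn (fun t => greenG m t t) (Set.Icc 0 1) := by
    refine ContinuousOn.congr (f := fun t => 1 / (Nat.factorial m : ℝ) ^ 2 *
      (t ^ (m + 1) * t ^ m * focalInt m 1)) (by fun_prop) fun t ht => ?_
    rcases ht.1.eq_or_lt with rfl | h
    · simp [greenG_zero_right]
    · simp only [greenG_eq_focalInt m h le_rfl, div_self h.ne']
  have hone : ContinuousOn (fun t => greenG m t 1) (Set.Icc 0 1) := by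
    have := continuous_focalInt m
    refine ContinuousOn.congr (f := fun t => 1 / (Nat.factorial m : ℝ) ^ 2 *
      (t ^ (m + 1) * focalInt m t)) (by fun_prop) fun t ht => ?_
    simp only [greenG_comm m t 1, greenG_eq_focalInt m one_pos ht.2, one_pow, mul_one, div_one]
  exact (hdiag.mul continuousOn_const).sqrt.sub (hone.mul hone).sqrt

theorem max_on_diagonal (m : ℕ) :
    ∃ t₀ ∈ Set.Icc (0:ℝ) 1, ∀ t ∈ Set.Icc (0:ℝ) 1, ∀ s ∈ Set.Icc (0:ℝ) 1,
      funcM m t s ≤ funcM m t₀ t₀ := by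
  obtain ⟨t₀, ht₀, hmax⟩ := isCompact_Icc.exists_isMaxOn (Set.nonempty_Icc.2 zero_le_one)
    (continuousOn_funcM_diag m)
  have hle : ∀ t s, 0 ≤ s → s ≤ t → t ≤ 1 → funcM m t s ≤ funcM m t₀ t₀ := by
    intro t s hs hst ht
    rcases hs.eq_or_lt with rfl | hs
    · refine le_trans (le_of_eq ?_) (hmax (Set.left_mem_Icc.2 zero_le_one))
      simp [funcM, greenG_zero_right, hst, greenG_comm m 0 1]
    · exact (funcM_le_funcM_sqrt_mul m hs hst ht).trans
        (hmax ⟨Real.sqrt_nonneg _, Real.sqrt_le_one.2 (by nlinarith)⟩)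
  refine ⟨t₀, ht₀, fun t ht s hs => ?_⟩
  rcases le_total s t with h | h
  · exact hle t s hs.1 h ht.2
  · rw [funcM_comm]
    exact hle s t ht.1 h hs.2
end

section
/- Let m ≥ 0 be an integer. Then M(t,s) > 0 for all t,s ∈ (0,1). -/
open MeasureTheory intervalIntegral

/-- The truncated power kernel `(x - τ)₊ ^ m`. -/
noncomputable def truncPow (m : ℕ) (x τ : ℝ) : ℝ := (max (x - τ) 0) ^ m

lemma continuous_truncPow (m : ℕ) (x : ℝ) : Continuous (truncPow m x) := by
  unfold truncPow; fun_prop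

lemma truncPow_nonneg (m : ℕ) (x τ : ℝ) : 0 ≤ truncPow m x τ :=
  pow_nonneg (le_max_right _ _) _

lemma truncPow_pos (m : ℕ) {x τ : ℝ} (h : τ < x) : 0 < truncPow m x τ :=
  pow_pos (lt_max_of_lt_left (sub_pos.2 h)) _

lemma truncPow_eq_zero {m : ℕ} (hm : m ≠ 0) {x τ : ℝ} (h : x ≤ τ) : truncPow m x τ = 0 := by
  rw [truncPow, max_eq_right (by linarith), zero_pow hm]

/-- The truncated power kernel is totally positive of order two. -/
lemma truncPow_mul_le (m : ℕ) {x a b : ℝ} (hx : x ≤ 1) (hab : a ≤ b) (hb : b ≤ 1) :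
    truncPow m x b * truncPow m 1 a ≤ truncPow m x a * truncPow m 1 b := by
  simp only [truncPow, ← mul_pow]
  refine pow_le_pow_left₀ (mul_nonneg (le_max_right _ _) (le_max_right _ _)) ?_ m
  rw [max_eq_left (by linarith : 0 ≤ 1 - a), max_eq_left (by linarith : 0 ≤ 1 - b)]
  rcases le_total x b with h | h
  · rw [max_eq_right (by linarith : x - b ≤ 0), zero_mul]
    exact mul_nonneg (le_max_right _ _) (by linarith)
  · rw [max_eq_left (by linarith : 0 ≤ x - b), max_eq_left (by linarith : 0 ≤ x - a)]
    nlinarith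

lemma truncPow_mul_lt {m : ℕ} (hm : m ≠ 0) {x a b : ℝ} (hax : a < x) (hx : x < 1) (hab : a < b)
    (hb : b < 1) : truncPow m x b * truncPow m 1 a < truncPow m x a * truncPow m 1 b := by
  simp only [truncPow, ← mul_pow]
  refine pow_lt_pow_left₀ ?_ (mul_nonneg (le_max_right _ _) (le_max_right _ _)) hm
  rw [max_eq_left (by linarith : 0 ≤ 1 - a), max_eq_left (by linarith : 0 ≤ 1 - b),
    max_eq_left (by linarith : 0 ≤ x - a)]
  rcases le_total x b with h | h
  · rw [max_eq_right (by linarith : x - b ≤ 0), zero_mul]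
    exact mul_pos (by linarith) (by linarith)
  · rw [max_eq_left (by linarith : 0 ≤ x - b)]
    nlinarith

lemma greenG_eq_integral_truncPow {m : ℕ} (hm : m ≠ 0) {t s : ℝ} (ht : t ∈ Set.Icc (0 : ℝ) 1)
    (hs : s ∈ Set.Icc (0 : ℝ) 1) :
    greenG m t s =
      (1 / (Nat.factorial m : ℝ) ^ 2) * ∫ τ in (0 : ℝ)..1, truncPow m t τ * truncPow m s τ := by
  have hc : Continuous fun τ => truncPow m t τ * truncPow m s τ :=
    (continuous_truncPow m t).mul (continuous_truncPow m s)
  have h0 : 0 ≤ min s t := le_min hs.1 ht.1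
  have h1 : min s t ≤ 1 := (min_le_left _ _).trans hs.2
  have htail : ∫ τ in (min s t)..1, truncPow m t τ * truncPow m s τ = 0 := by
    refine integral_zero_ae (.of_forall fun τ hτ => ?_)
    rw [Set.uIoc_of_le h1] at hτ
    rcases min_lt_iff.1 hτ.1 with h | h
    · rw [truncPow_eq_zero hm h.le, mul_zero]
    · rw [truncPow_eq_zero hm h.le, zero_mul]
  rw [greenG, ← integral_add_adjacent_intervals (hc.intervalIntegrable 0 (min s t))
    (hc.intervalIntegrable (min s t) 1), htail, add_zero]
  congr 1
  refine integral_congr fun τ hτ => ?_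
  rw [Set.uIcc_of_le h0] at hτ
  obtain ⟨h2, h3⟩ := le_min_iff.1 hτ.2
  simp only [truncPow]
  rw [max_eq_left (sub_nonneg.2 h2), max_eq_left (sub_nonneg.2 h3)]

/-- A strict Chebyshev integral inequality for truncated powers. -/
lemma integral_truncPow_mul_lt {m : ℕ} (hm : m ≠ 0) {t s : ℝ} (ht : t ∈ Set.Ioo (0 : ℝ) 1)
    (hs : s ∈ Set.Ioo (0 : ℝ) 1) :
    (∫ τ in (0 : ℝ)..1, truncPow m t τ * truncPow m 1 τ) *
        (∫ τ in (0 : ℝ)..1, truncPow m s τ * truncPow m 1 τ) <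
      (∫ τ in (0 : ℝ)..1, truncPow m t τ * truncPow m s τ) *
        ∫ τ in (0 : ℝ)..1, truncPow m 1 τ * truncPow m 1 τ := by
  have hk := continuous_truncPow m
  have hint : ∀ x y, IntervalIntegrable (fun τ => truncPow m x τ * truncPow m y τ) volume 0 1 :=
    fun x y => ((hk x).mul (hk y)).intervalIntegrable 0 1
  have hpos : ∀ x > 0, ∀ y > 0, 0 < ∫ τ in (0 : ℝ)..1, truncPow m x τ * truncPow m y τ :=
    fun x hx y hy => integral_pos one_pos ((hk x).mul (hk y)).continuousOn
      (fun τ _ => mul_nonneg (truncPow_nonneg _ _ _) (truncPow_nonneg _ _ _))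
      ⟨0, by simp, mul_pos (truncPow_pos m hx) (truncPow_pos m hy)⟩
  have hexp : ∀ x y α β γ δ : ℝ,
      ∫ τ in (0 : ℝ)..1, (α * truncPow m x τ - β * truncPow m 1 τ) *
          (γ * truncPow m y τ - δ * truncPow m 1 τ) =
        α * γ * (∫ τ in (0 : ℝ)..1, truncPow m x τ * truncPow m y τ)
        - α * δ * (∫ τ in (0 : ℝ)..1, truncPow m x τ * truncPow m 1 τ)
        - β * γ * (∫ τ in (0 : ℝ)..1, truncPow m y τ * truncPow m 1 τ)
        + β * δ * ∫ τ in (0 : ℝ)..1, truncPow m 1 τ * truncPow m 1 τ := by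
    intro x y α β γ δ
    simp only [← intervalIntegral.integral_const_mul]
    rw [← integral_sub ((hint _ _).const_mul _) ((hint _ _).const_mul _),
      ← integral_sub (((hint _ _).const_mul _).sub ((hint _ _).const_mul _))
        ((hint _ _).const_mul _),
      ← integral_add ((((hint _ _).const_mul _).sub ((hint _ _).const_mul _)).sub
        ((hint _ _).const_mul _)) ((hint _ _).const_mul _)]
    exact integral_congr fun τ _ => by ring
  set A := ∫ τ in (0 : ℝ)..1, truncPow m t τ * truncPow m 1 τ with hA
  set B := ∫ τ in (0 : ℝ)..1, truncPow m 1 τ * truncPow m 1 τ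
  set C := ∫ τ in (0 : ℝ)..1, truncPow m s τ * truncPow m 1 τ with hC
  set D := ∫ τ in (0 : ℝ)..1, truncPow m t τ * truncPow m s τ with hD
  have hA0 : 0 < A := hpos t ht.1 1 one_pos
  have hB0 : 0 < B := hpos 1 one_pos 1 one_pos
  have hone : truncPow m 1 0 = 1 := by simp [truncPow]
  have hAB : A < truncPow m t 0 * B := by
    have h : 0 < ∫ τ in (0 : ℝ)..1,
        (truncPow m t 0 * (truncPow m 1 τ * truncPow m 1 τ) - truncPow m t τ * truncPow m 1 τ) := by
      refine integral_pos one_pos (Continuous.continuousOn (by fun_prop)) (fun τ hτ => ?_)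
        ⟨t, ⟨ht.1.le, ht.2.le⟩, ?_⟩
      · have := truncPow_mul_le m ht.2.le hτ.1.le hτ.2
        rw [hone, mul_one] at this
        nlinarith [truncPow_nonneg m 1 τ]
      · have h1 := truncPow_pos m ht.2
        have h2 := truncPow_pos m ht.1
        rw [truncPow_eq_zero hm le_rfl, zero_mul, sub_zero]
        positivity
    rw [integral_sub ((hint _ _).const_mul _) (hint _ _),
      intervalIntegral.integral_const_mul] at h
    linarith
  obtain ⟨b, hb, hbz⟩ : ∃ b ∈ Set.Icc 0 t, B * truncPow m t b - A * truncPow m 1 b = 0 := by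
    refine intermediate_value_Icc' ht.1.le
      (f := fun b => B * truncPow m t b - A * truncPow m 1 b)
      (Continuous.continuousOn (by fun_prop)) ⟨?_, ?_⟩
    · simp only [truncPow_eq_zero hm (le_refl t)]
      nlinarith [truncPow_nonneg m 1 t]
    · simp only [hone]
      linarith
  have hb0 : 0 < b := by
    refine lt_of_le_of_ne hb.1 fun h => ?_
    rw [← h, hone] at hbz
    linarith
  have hb1 : b < 1 := hb.2.trans_lt ht.2
  have hq : 0 < truncPow m 1 b := truncPow_pos m hb1
  have hmain : 0 < ∫ τ in (0 : ℝ)..1,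
      (truncPow m 1 b * truncPow m t τ - truncPow m t b * truncPow m 1 τ) *
        (truncPow m 1 b * truncPow m s τ - truncPow m s b * truncPow m 1 τ) := by
    refine integral_pos one_pos (Continuous.continuousOn (by fun_prop)) (fun τ hτ => ?_)
      ⟨0, by simp, ?_⟩
    · rcases le_total τ b with h | h
      · have h1 := truncPow_mul_le m ht.2.le h hb1.le
        have h2 := truncPow_mul_le m hs.2.le h hb1.le
        exact mul_nonneg (by linarith) (by linarith)
      · have h1 := truncPow_mul_le m ht.2.le h hτ.2
        have h2 := truncPow_mul_le m hs.2.le h hτ.2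
        exact mul_nonneg_of_nonpos_of_nonpos (by linarith) (by linarith)
    · have h1 := truncPow_mul_lt hm ht.1 ht.2 hb0 hb1
      have h2 := truncPow_mul_lt hm hs.1 hs.2 hb0 hb1
      exact mul_pos (by linarith) (by linarith)
  rw [hexp, ← hA, ← hC, ← hD] at hmain
  have hid : B * (truncPow m 1 b * truncPow m 1 b * D - truncPow m 1 b * truncPow m s b * A
      - truncPow m t b * truncPow m 1 b * C + truncPow m t b * truncPow m s b * B) =
      truncPow m 1 b ^ 2 * (D * B - A * C) := by
    linear_combination (truncPow m s b * B - truncPow m 1 b * C) * hbz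
  have := hid ▸ mul_pos hB0 hmain
  exact sub_pos.1 (pos_of_mul_pos_right this (by positivity))

lemma greenG_nonneg (m : ℕ) {t s : ℝ} (ht : 0 ≤ t) (hs : 0 ≤ s) : 0 ≤ greenG m t s := by
  refine mul_nonneg (by positivity) (integral_nonneg (le_min hs ht) fun τ hτ => ?_)
  obtain ⟨h1, h2⟩ := le_min_iff.1 hτ.2
  exact mul_nonneg (pow_nonneg (sub_nonneg.2 h2) _) (pow_nonneg (sub_nonneg.2 h1) _)

lemma greenG_mul_lt (m : ℕ) {t s : ℝ} (ht : t ∈ Set.Ioo (0 : ℝ) 1) (hs : s ∈ Set.Ioo (0 : ℝ) 1) :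
    greenG m t 1 * greenG m s 1 < greenG m t s * greenG m 1 1 := by
  rcases eq_or_ne m 0 with rfl | hm
  · simp only [greenG, pow_zero, Nat.factorial_zero, Nat.cast_one, one_pow, div_one, one_mul,
      mul_one, intervalIntegral.integral_const, sub_zero, smul_eq_mul, min_self,
      min_eq_right ht.2.le, min_eq_right hs.2.le]
    exact lt_min (mul_lt_of_lt_one_left hs.1 ht.2) (mul_lt_of_lt_one_right ht.1 hs.2)
  · have h1 : (1 : ℝ) ∈ Set.Icc (0 : ℝ) 1 := ⟨zero_le_one, le_rfl⟩
    have ht' := Set.Ioo_subset_Icc_self ht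
    have hs' := Set.Ioo_subset_Icc_self hs
    rw [greenG_eq_integral_truncPow hm ht' h1, greenG_eq_integral_truncPow hm hs' h1,
      greenG_eq_integral_truncPow hm ht' hs', greenG_eq_integral_truncPow hm h1 h1]
    have hc : (0 : ℝ) < (1 / (Nat.factorial m : ℝ) ^ 2) ^ 2 := by positivity
    linarith [mul_lt_mul_of_pos_left (integral_truncPow_mul_lt hm ht hs) hc]

theorem funcM_pos (m : ℕ) :
    ∀ t ∈ Set.Ioo (0:ℝ) 1, ∀ s ∈ Set.Ioo (0:ℝ) 1, 0 < funcM m t s := by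
  intro t ht s hs
  exact sub_pos.2 (Real.sqrt_lt_sqrt
    (mul_nonneg (greenG_nonneg m ht.1.le zero_le_one) (greenG_nonneg m hs.1.le zero_le_one))
    (greenG_mul_lt m ht hs))
end

section
/- Let m ≥ 1 be an integer. For all 0 < s < t < 1 the following strict inequality holds: [∫₀^{s} (s−τ)^m (1−τ)^m dτ / ∫₀^{s} (s−τ)^{m−1} (1−τ)^m dτ] · [∫₀^{t} (t−τ)^{m−1} (1−τ)^m dτ / ∫₀^{t} (t−τ)^m (1−τ)^m dτ] > [∫₀^{s} (s−τ)^m (t−τ)^{m−1} dτ] / [∫₀^{s} (t−τ)^m (s−τ)^{m−1} dτ]. (Equivalently, with G the Green function of the focal problem, (G(1,s)/∂_s G(1,s)) / (G(t,1)/∂_t G(t,1)) > ∂_t G(t,s)/∂_s G(t,s).) -/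
open MeasureTheory intervalIntegral

theorem nonneg_of_deriv_pos_of_eq_zero {f f' : ℝ → ℝ}
    (hf : ∀ x ∈ Set.Ico (0 : ℝ) 1, HasDerivAt f (f' x) x) (h0 : 0 ≤ f 0)
    (hpos : ∀ x ∈ Set.Ico (0 : ℝ) 1, f x = 0 → 0 < f' x) :
    ∀ x ∈ Set.Ico (0 : ℝ) 1, 0 ≤ f x := by
  intro x hx
  have hsub : ∀ y ∈ Set.Icc (0 : ℝ) x, y ∈ Set.Ico (0 : ℝ) 1 := fun y hy =>
    ⟨hy.1, hy.2.trans_lt hx.2⟩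
  have hsub' : ∀ y ∈ Set.Ico (0 : ℝ) x, y ∈ Set.Ico (0 : ℝ) 1 := fun y hy =>
    ⟨hy.1, hy.2.trans hx.2⟩
  exact image_le_of_deriv_right_lt_deriv_boundary' (f := fun _ => 0) (f' := fun _ => 0)
    continuousOn_const (fun y _ => hasDerivWithinAt_const y _ 0) h0
    (fun y hy => (hf y (hsub y hy)).continuousAt.continuousWithinAt)
    (fun y hy => (hf y (hsub' y hy)).hasDerivWithinAt)
    (fun y hy h => hpos y (hsub' y hy) h.symm) ⟨hx.1, le_rfl⟩

section Riccati

variable {m : ℝ} {q q' : ℝ → ℝ}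

theorem riccati_nonneg (hm : 1 ≤ m)
    (hq : ∀ x ∈ Set.Ico (0 : ℝ) 1, HasDerivAt q (q' x) x) (h0 : q 0 = 0)
    (h0' : q' 0 = m / (m + 2))
    (hode : ∀ x ∈ Set.Ico (0 : ℝ) 1,
      x * (1 - x) * q' x = m * x - q x * (m + 1 + m * x - (1 - x) * q x) + x * q x) :
    ∀ x ∈ Set.Ico (0 : ℝ) 1, 0 ≤ q x := by
  refine nonneg_of_deriv_pos_of_eq_zero hq h0.ge fun x hx hqx => ?_
  rcases hx.1.eq_or_lt with rfl | hx0
  · rw [h0']; positivity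
  · have h := hode x hx
    rw [hqx] at h
    have h1 : 0 < 1 - x := sub_pos.2 hx.2
    have : 0 < x * (1 - x) * q' x := by rw [h]; ring_nf; positivity
    exact pos_of_mul_pos_right this (by positivity)

theorem riccati_le (hm : 1 ≤ m)
    (hq : ∀ x ∈ Set.Ico (0 : ℝ) 1, HasDerivAt q (q' x) x) (h0 : q 0 = 0)
    (hode : ∀ x ∈ Set.Ico (0 : ℝ) 1,
      x * (1 - x) * q' x = m * x - q x * (m + 1 + m * x - (1 - x) * q x) + x * q x) :
    ∀ x ∈ Set.Ico (0 : ℝ) 1, q x ≤ (1 + x) / 4 := by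
  have key : ∀ x ∈ Set.Ico (0 : ℝ) 1, 0 ≤ (1 + x) / 4 - q x := by
    refine nonneg_of_deriv_pos_of_eq_zero (f' := fun x => 1 / 4 - q' x)
      (fun x hx => (((hasDerivAt_id x).const_add 1).div_const 4).sub (hq x hx))
      (by rw [h0]; norm_num) fun x hx hqx => ?_
    rcases hx.1.eq_or_lt with rfl | hx0
    · rw [h0] at hqx; norm_num at hqx
    · have h := hode x hx
      have hqx' : q x = (1 + x) / 4 := by linarith
      rw [hqx'] at h
      have h1 : 0 < 1 - x := sub_pos.2 hx.2
      have : 0 < x * (1 - x) * (1 / 4 - q' x) := by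
        have : x * (1 - x) * (1 / 4 - q' x) = x * (1 - x) / 4 + m * (1 - x) ^ 2 / 4
            + (1 - x) * ((1 + x) / 4) * (1 - (1 + x) / 4) := by
          rw [mul_sub, h]; ring
        rw [this]
        have : 0 < 1 - (1 + x) / 4 := by linarith
        positivity
      exact pos_of_mul_pos_right this (by positivity)
  exact fun x hx => sub_nonneg.1 (key x hx)

theorem riccati_monotoneOn_mul_deriv (hm : 1 ≤ m)
    (hq : ∀ x ∈ Set.Ico (0 : ℝ) 1, HasDerivAt q (q' x) x) (h0 : q 0 = 0)
    (h0' : q' 0 = m / (m + 2))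
    (hode : ∀ x ∈ Set.Ico (0 : ℝ) 1,
      x * (1 - x) * q' x = m * x - q x * (m + 1 + m * x - (1 - x) * q x) + x * q x) :
    MonotoneOn (fun x => x * q' x) (Set.Ico (0 : ℝ) 1) := by
  have hnn := riccati_nonneg hm hq h0 h0' hode
  have hle := riccati_le hm hq h0 hode
  set S : ℝ → ℝ := fun x =>
    (m * x - q x * (m + 1 + m * x - (1 - x) * q x) + x * q x) / (1 - x) with hSdef
  set S' : ℝ → ℝ := fun x =>
    (m - q' x * (m + 1 + m * x - (1 - x) * q x) - q x * (m + q x - (1 - x) * q' x)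
      + q x + x * q' x + S x) / (1 - x) with hS'def
  have hne : ∀ x ∈ Set.Ico (0 : ℝ) 1, 1 - x ≠ 0 := fun x hx => (sub_pos.2 hx.2).ne'
  have hSq : ∀ x ∈ Set.Ico (0 : ℝ) 1, x * q' x = S x := by
    intro x hx
    rw [hSdef, eq_div_iff (hne x hx), ← hode x hx]; ring
  have hS : ∀ x ∈ Set.Ico (0 : ℝ) 1, HasDerivAt S (S' x) x := by
    intro x hx
    have h1 := hne x hx
    have hx' := hasDerivAt_id' x
    have hq := hq x hx
    have := ((((hx'.const_mul m).sub (hq.mul (((hx'.const_mul m).const_add (m + 1)).sub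
      ((hx'.const_sub 1).mul hq)))).add (hx'.mul hq))).div (hx'.const_sub 1) h1
    refine this.congr_deriv ?_
    simp only [hS'def, hSdef, Pi.sub_apply, Pi.add_apply, Pi.mul_apply]
    field_simp
    ring
  set K : ℝ → ℝ := fun x => m * (1 + x) - x + (1 - x) * (1 - 2 * q x) with hKdef
  set N : ℝ → ℝ := fun x => x * (m + q x) * (1 - q x) - S x * K x with hNdef
  have hSN : ∀ x ∈ Set.Ico (0 : ℝ) 1, x * (1 - x) * S' x = N x := by
    intro x hx
    have h1 := hne x hx
    have e1 : S' x * (1 - x) = m - q' x * (m + 1 + m * x - (1 - x) * q x)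
        - q x * (m + q x - (1 - x) * q' x) + q x + x * q' x + S x := by
      rw [hS'def]; exact div_mul_cancel₀ _ h1
    simp only [hNdef, hKdef]
    linear_combination x * e1 +
      (-(m + 1 + m * x - (1 - x) * q x) + q x * (1 - x) + x) * hSq x hx
  set N' : ℝ → ℝ := fun x => (m + q x) * (1 - q x) + x * q' x * (1 - m - 2 * q x)
    - S' x * K x - S x * (m - 1 - (1 - 2 * q x) - 2 * (1 - x) * q' x) with hN'def
  have hN : ∀ x ∈ Set.Ico (0 : ℝ) 1, HasDerivAt N (N' x) x := by
    intro x hx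
    have hx' := hasDerivAt_id' x
    have hq := hq x hx
    have hS := hS x hx
    have hK : HasDerivAt K (m - 1 - (1 - 2 * q x) - 2 * (1 - x) * q' x) x := by
      have := (((hx'.const_add 1).const_mul m).sub hx').add
        ((hx'.const_sub 1).mul ((hq.const_mul 2).const_sub 1))
      exact this.congr_deriv (by ring)
    have := ((hx'.mul (hq.const_add m)).mul (hq.const_sub 1)).sub (hS.mul hK)
    refine this.congr_deriv ?_
    simp only [hN'def, Pi.mul_apply]
    ring
  have hNnn : ∀ x ∈ Set.Ico (0 : ℝ) 1, 0 ≤ N x := by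
    refine nonneg_of_deriv_pos_of_eq_zero hN (by simp [hNdef, hSdef, h0]) fun x hx hNx => ?_
    rcases hx.1.eq_or_lt with rfl | hx0
    · have : N' 0 = m / (m + 2) := by
        simp only [hN'def, hS'def, hKdef, hSdef, h0, h0']
        have : m + 2 ≠ 0 := by positivity
        field_simp
        ring
      rw [this]; positivity
    · have h1 : 0 < 1 - x := sub_pos.2 hx.2
      have hS'0 : S' x = 0 := by
        have := hSN x hx
        rw [hNx] at this
        exact (mul_eq_zero.1 this).resolve_left (by positivity)
      have hq0 := hnn x hx
      have hq1 := hle x hx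
      have hq2 : 0 < 1 - 2 * q x := by linarith
      have hK : 0 < K x := by
        have : K x = m + (m - 1) * x + (1 - x) * (1 - 2 * q x) := by simp only [hKdef]; ring
        rw [this]
        have : 0 ≤ m - 1 := by linarith
        positivity
      have hSK : S x * K x = x * (m + q x) * (1 - q x) := by
        simp only [hNdef] at hNx; linarith
      have hSpos : 0 < S x := by
        have h3 : 0 < 1 - q x := by linarith
        have : 0 < S x * K x := by rw [hSK]; positivity
        exact pos_of_mul_pos_left this hK.le
      have : x * N' x = S x * (m * (1 - x) + 2 * x * (1 - 2 * q x) + (1 - x) * (1 - 2 * q x))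
          + 2 * (1 - x) * S x ^ 2 := by
        simp only [hN'def, hS'0]
        simp only [hKdef] at hSK
        linear_combination (x * (1 - m - 2 * q x) + 2 * S x * (1 - x)) * hSq x hx - hSK
      have : 0 < x * N' x := by rw [this]; positivity
      exact pos_of_mul_pos_right this hx0.le
  have hSmono : MonotoneOn S (Set.Ico (0 : ℝ) 1) := by
    refine monotoneOn_of_deriv_nonneg (convex_Ico 0 1)
      (fun x hx => (hS x hx).continuousAt.continuousWithinAt) ?_ ?_
    · intro x hx
      rw [interior_Ico] at hx
      exact (hS x ⟨hx.1.le, hx.2⟩).differentiableAt.differentiableWithinAt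
    · intro x hx
      rw [interior_Ico] at hx
      have hx' : x ∈ Set.Ico (0 : ℝ) 1 := ⟨hx.1.le, hx.2⟩
      rw [(hS x hx').deriv]
      have h1 : 0 < x * (1 - x) := mul_pos hx.1 (sub_pos.2 hx.2)
      exact nonneg_of_mul_nonneg_right (by rw [hSN x hx']; exact hNnn x hx') h1
  intro x hx y hy hxy
  simp only [hSq x hx, hSq y hy]
  exact hSmono hx hy hxy

theorem riccati_monotoneOn_sub_comp_mul (hm : 1 ≤ m)
    (hq : ∀ x ∈ Set.Ico (0 : ℝ) 1, HasDerivAt q (q' x) x) (h0 : q 0 = 0)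
    (h0' : q' 0 = m / (m + 2))
    (hode : ∀ x ∈ Set.Ico (0 : ℝ) 1,
      x * (1 - x) * q' x = m * x - q x * (m + 1 + m * x - (1 - x) * q x) + x * q x)
    {x : ℝ} (hx : x ∈ Set.Ioo (0 : ℝ) 1) :
    MonotoneOn (fun t => q t - q (x * t)) (Set.Ico (0 : ℝ) 1) := by
  have hmono := riccati_monotoneOn_mul_deriv hm hq h0 h0' hode
  have hxt : ∀ t ∈ Set.Ico (0 : ℝ) 1, x * t ∈ Set.Ico (0 : ℝ) 1 := fun t ht =>
    ⟨mul_nonneg hx.1.le ht.1, mul_lt_one_of_nonneg_of_lt_one_left hx.1.le hx.2 ht.2.le⟩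
  have hD : ∀ t ∈ Set.Ico (0 : ℝ) 1,
      HasDerivAt (fun t => q t - q (x * t)) (q' t - q' (x * t) * x) t := fun t ht => by
    have h1 : HasDerivAt (fun t => x * t) x t := by
      simpa using (hasDerivAt_id' t).const_mul x
    exact (hq t ht).sub (HasDerivAt.comp t (hq _ (hxt t ht)) h1)
  refine monotoneOn_of_deriv_nonneg (convex_Ico 0 1)
    (fun t ht => (hD t ht).continuousAt.continuousWithinAt) ?_ ?_
  · intro t ht
    rw [interior_Ico] at ht
    exact (hD t ⟨ht.1.le, ht.2⟩).differentiableAt.differentiableWithinAt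
  · intro t ht
    rw [interior_Ico] at ht
    have ht' : t ∈ Set.Ico (0 : ℝ) 1 := ⟨ht.1.le, ht.2⟩
    rw [(hD t ht').deriv]
    have h := hmono (hxt t ht') ht' (mul_le_of_le_one_left ht.1.le hx.2.le)
    refine nonneg_of_mul_nonneg_right (a := t) ?_ ht.1
    simp only at h
    linarith

theorem riccati_sub_comp_mul_le (hm : 1 ≤ m)
    (hq : ∀ x ∈ Set.Ico (0 : ℝ) 1, HasDerivAt q (q' x) x) (h0 : q 0 = 0)
    (h0' : q' 0 = m / (m + 2))
    (hode : ∀ x ∈ Set.Ico (0 : ℝ) 1,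
      x * (1 - x) * q' x = m * x - q x * (m + 1 + m * x - (1 - x) * q x) + x * q x)
    (hc : ContinuousAt q 1) {x t : ℝ} (hx : x ∈ Set.Ioo (0 : ℝ) 1) (ht : t ∈ Set.Ico (0 : ℝ) 1) :
    q t - q (x * t) ≤ q 1 - q x := by
  have hmono := riccati_monotoneOn_sub_comp_mul hm hq h0 h0' hode hx
  have hxc : ContinuousAt q (x * 1) := by
    rw [mul_one]; exact (hq x ⟨hx.1.le, hx.2⟩).continuousAt
  have hcont : ContinuousAt (fun u => q u - q (x * u)) 1 :=
    hc.sub (ContinuousAt.comp (f := fun u => x * u) hxc (by fun_prop))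
  have hlim := hcont.tendsto.mono_left (nhdsWithin_le_nhds (s := Set.Iio 1))
  rw [mul_one] at hlim
  refine ge_of_tendsto hlim ?_
  filter_upwards [Ioo_mem_nhdsLT ht.2] with u hu
  exact hmono ht ⟨ht.1.trans hu.1.le, hu.2⟩ hu.1.le

end Riccati

/-- The Euler-type integral `∫₀¹ (1 - v) ^ a (1 - x v) ^ b dv`. -/
noncomputable def eulerIntegral (a b : ℕ) (x : ℝ) : ℝ :=
  ∫ v in (0 : ℝ)..1, (1 - v) ^ a * (1 - x * v) ^ b

namespace eulerIntegral

theorem integral_sub_pow_mul_sub_pow (a b : ℕ) {s c x : ℝ} (h : s = x * c) :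
    ∫ τ in (0 : ℝ)..s, (s - τ) ^ a * (c - τ) ^ b = s ^ (a + 1) * c ^ b * eulerIntegral a b x := by
  have h1 := intervalIntegral.mul_integral_comp_mul_left (a := 0) (b := 1)
    (f := fun τ : ℝ => (s - τ) ^ a * (c - τ) ^ b) (c := s)
  rw [mul_zero, mul_one] at h1
  rw [← h1, eulerIntegral, ← intervalIntegral.integral_const_mul,
    ← intervalIntegral.integral_const_mul]
  refine intervalIntegral.integral_congr fun v _ => ?_
  have e1 : s - s * v = s * (1 - v) := by ring
  have e2 : c - s * v = c * (1 - x * v) := by rw [h]; ring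
  simp only [e1, e2, mul_pow]
  ring

theorem continuous (a b : ℕ) : Continuous (eulerIntegral a b) :=
  intervalIntegral.continuous_parametric_intervalIntegral_of_continuous'
    (f := fun x v : ℝ => (1 - v) ^ a * (1 - x * v) ^ b) (by fun_prop) 0 1

theorem intervalIntegrable (a b : ℕ) (x : ℝ) :
    IntervalIntegrable (fun v : ℝ => (1 - v) ^ a * (1 - x * v) ^ b) volume 0 1 :=
  (by fun_prop : Continuous fun v : ℝ => (1 - v) ^ a * (1 - x * v) ^ b).intervalIntegrable 0 1

theorem pos (a b : ℕ) {x : ℝ} (hx : x ≤ 1) : 0 < eulerIntegral a b x := by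
  refine intervalIntegral_pos_of_pos_on (intervalIntegrable a b x) (fun v hv => ?_) one_pos
  have h1 : 0 < 1 - v := sub_pos.2 hv.2
  have h2 : 0 < 1 - x * v := by nlinarith [hv.1]
  positivity

theorem succ_right (a b : ℕ) (x : ℝ) :
    eulerIntegral a (b + 1) x = (1 - x) * eulerIntegral a b x + x * eulerIntegral (a + 1) b x := by
  simp only [eulerIntegral]
  rw [← intervalIntegral.integral_const_mul, ← intervalIntegral.integral_const_mul,
    ← intervalIntegral.integral_add ((intervalIntegrable a b x).const_mul _)
      ((intervalIntegrable (a + 1) b x).const_mul _)]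
  exact intervalIntegral.integral_congr fun v _ => by ring

theorem integration_by_parts (a b : ℕ) (x : ℝ) :
    (a + 1) * eulerIntegral a (b + 1) x + (b + 1) * x * eulerIntegral (a + 1) b x = 1 := by
  simp only [eulerIntegral]
  rw [← intervalIntegral.integral_const_mul, ← intervalIntegral.integral_const_mul,
    ← intervalIntegral.integral_add ((intervalIntegrable a (b + 1) x).const_mul _)
      ((intervalIntegrable (a + 1) b x).const_mul _)]
  have hd : ∀ v ∈ Set.uIcc (0 : ℝ) 1,
      HasDerivAt (fun v : ℝ => -((1 - v) ^ (a + 1) * (1 - x * v) ^ (b + 1)))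
        ((a + 1) * ((1 - v) ^ a * (1 - x * v) ^ (b + 1))
          + (b + 1) * x * ((1 - v) ^ (a + 1) * (1 - x * v) ^ b)) v := fun v _ => by
    have h1 := ((hasDerivAt_id' v).const_sub 1).pow (a + 1)
    have h2 := (((hasDerivAt_id' v).const_mul x).const_sub 1).pow (b + 1)
    refine (h1.mul h2).neg.congr_deriv ?_
    simp only [Pi.pow_apply, Nat.add_sub_cancel, Nat.cast_add, Nat.cast_one]
    ring
  rw [intervalIntegral.integral_eq_sub_of_hasDerivAt hd
    (Continuous.intervalIntegrable (by fun_prop) 0 1)]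
  simp

theorem apply_zero (a b : ℕ) : eulerIntegral a b 0 = 1 / (a + 1) := by
  have h := integration_by_parts a b 0
  rw [mul_zero, zero_mul, add_zero, succ_right, sub_zero, one_mul, zero_mul, add_zero] at h
  rw [eq_div_iff (by positivity), mul_comm, h]

theorem apply_one (a b : ℕ) : eulerIntegral a b 1 = 1 / (a + b + 1) := by
  cases b with
  | zero =>
    have : eulerIntegral a 0 1 = eulerIntegral a 0 0 := by simp [eulerIntegral]
    rw [this, apply_zero]; simp
  | succ b =>
    have h := integration_by_parts a b 1
    have h' := succ_right a b 1
    rw [sub_self, zero_mul, zero_add, one_mul] at h'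
    rw [← h'] at h
    rw [eq_div_iff (by positivity)]
    push_cast
    linarith

theorem hasDerivAt (a b : ℕ) (x : ℝ) :
    HasDerivAt (eulerIntegral a (b + 1))
      (-((b + 1) * (eulerIntegral a b x - eulerIntegral (a + 1) b x))) x := by
  have hF' : Continuous (fun p : ℝ × ℝ =>
      -((b + 1) * (p.2 * ((1 - p.2) ^ a * (1 - p.1 * p.2) ^ b)))) := by fun_prop
  obtain ⟨C, hC⟩ := ((isCompact_Icc (a := x - 1) (b := x + 1)).prod
    (isCompact_Icc (a := (0 : ℝ)) (b := 1))).exists_bound_of_continuousOn hF'.continuousOn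
  have h := (intervalIntegral.hasDerivAt_integral_of_dominated_loc_of_deriv_le
    (μ := volume) (a := 0) (b := 1) (bound := fun _ => C)
    (F := fun x v : ℝ => (1 - v) ^ a * (1 - x * v) ^ (b + 1))
    (F' := fun x v : ℝ => -((b + 1) * (v * ((1 - v) ^ a * (1 - x * v) ^ b))))
    (Icc_mem_nhds (sub_one_lt x) (lt_add_one x))
    (Filter.Eventually.of_forall fun y => (by fun_prop : Continuous fun v : ℝ =>
      (1 - v) ^ a * (1 - y * v) ^ (b + 1)).aestronglyMeasurable)
    (intervalIntegrable a (b + 1) x)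
    (by fun_prop : Continuous fun v : ℝ =>
      -((b + 1 : ℝ) * (v * ((1 - v) ^ a * (1 - x * v) ^ b)))).aestronglyMeasurable
    (Filter.Eventually.of_forall fun v hv y hy => by
      rw [Set.uIoc_of_le zero_le_one] at hv
      exact hC (y, v) ⟨hy, Set.Ioc_subset_Icc_self hv⟩)
    intervalIntegrable_const
    (Filter.Eventually.of_forall fun v _ y _ => by
      have h := ((((hasDerivAt_id' y).mul_const v).const_sub 1).pow (b + 1)).const_mul
        ((1 - v) ^ a)
      refine h.congr_deriv ?_
      simp only [Nat.add_sub_cancel, Nat.cast_add, Nat.cast_one]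
      ring)).2
  refine h.congr_deriv ?_
  simp only [eulerIntegral]
  rw [← intervalIntegral.integral_sub (intervalIntegrable a b x) (intervalIntegrable (a + 1) b x),
    ← intervalIntegral.integral_const_mul, ← intervalIntegral.integral_neg]
  exact intervalIntegral.integral_congr fun v _ => by ring

end eulerIntegral

/-- Minus the logarithmic derivative `x J'(x) / J(x)` of `J = eulerIntegral (n + 1) (n + 1)`. -/
noncomputable def eulerLogDeriv (n : ℕ) (x : ℝ) : ℝ :=
  x * ((n + 1) * (eulerIntegral (n + 1) n x - eulerIntegral (n + 2) n x))
    / eulerIntegral (n + 1) (n + 1) x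

namespace eulerLogDeriv

open eulerIntegral

theorem mul_eulerIntegral (n : ℕ) {x : ℝ} (hx : x ≤ 1) :
    eulerLogDeriv n x * eulerIntegral (n + 1) (n + 1) x =
      x * ((n + 1) * (eulerIntegral (n + 1) n x - eulerIntegral (n + 2) n x)) :=
  div_mul_cancel₀ _ (pos _ _ hx).ne'

theorem mul_left_integral (n : ℕ) {x : ℝ} (hx : x ≤ 1) :
    (n + 1) * eulerIntegral n (n + 1) x =
      (n + 1 + 1 - eulerLogDeriv n x) * eulerIntegral (n + 1) (n + 1) x := by
  have h1 := integration_by_parts n n x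
  have h2 := integration_by_parts (n + 1) n x
  push_cast at h2
  linear_combination h1 - h2 + mul_eulerIntegral n hx

theorem mul_right_integral (n : ℕ) {x : ℝ} (hx : x ≤ 1) :
    (n + 1) * eulerIntegral (n + 1) n x =
      (n + 1 + eulerLogDeriv n x) * eulerIntegral (n + 1) (n + 1) x := by
  have h := succ_right (n + 1) n x
  linear_combination -(n + 1) * h - mul_eulerIntegral n hx

theorem inv_eulerIntegral (n : ℕ) {x : ℝ} (hx : x ≤ 1) :
    (eulerIntegral (n + 1) (n + 1) x)⁻¹ =
      n + 1 + 1 + (n + 1) * x - (1 - x) * eulerLogDeriv n x := by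
  refine inv_eq_of_mul_eq_one_left ?_
  have h1 := integration_by_parts n (n + 1) x
  have h2 := succ_right n (n + 1) x
  push_cast at h1
  linear_combination h1 - (1 - x) * mul_left_integral n hx - (n + 1) * h2

theorem apply_one (n : ℕ) : eulerLogDeriv n 1 = 1 / 2 := by
  simp only [eulerLogDeriv, eulerIntegral.apply_one]
  push_cast
  have h1 : (n : ℝ) + 1 + n + 1 ≠ 0 := by positivity
  have h2 : (n : ℝ) + 2 + n + 1 ≠ 0 := by positivity
  have h3 : (n : ℝ) + 1 + (n + 1) + 1 ≠ 0 := by positivity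
  field_simp
  ring

theorem continuousAt_one (n : ℕ) : ContinuousAt (eulerLogDeriv n) 1 := by
  have h1 := (eulerIntegral.continuous (n + 1) n).continuousAt (x := 1)
  have h2 := (eulerIntegral.continuous (n + 2) n).continuousAt (x := 1)
  have h3 := (eulerIntegral.continuous (n + 1) (n + 1)).continuousAt (x := 1)
  exact (continuousAt_id.mul (continuousAt_const.mul (h1.sub h2))).div h3 (pos _ _ le_rfl).ne'

/-- The derivative of `eulerLogDeriv` on `(-∞, 1)`. -/
noncomputable def derivative (n : ℕ) (x : ℝ) : ℝ :=
  (n + 1 - (n + 1) * (eulerIntegral (n + 1) n x - eulerIntegral (n + 2) n x)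
    / eulerIntegral (n + 1) (n + 1) x * (eulerIntegral (n + 1) (n + 1) x)⁻¹
    + eulerLogDeriv n x) / (1 - x)

theorem hasDerivAt (n : ℕ) {x : ℝ} (hx : x < 1) :
    HasDerivAt (eulerLogDeriv n) (derivative n x) x := by
  have hne : 1 - x ≠ 0 := (sub_pos.2 hx).ne'
  have hP := pos (n + 1) (n + 1) hx.le
  have hx' := hasDerivAt_id' x
  have h := (((hx'.const_mul ((n : ℝ) + 1)).const_add ((n : ℝ) + 1 + 1)).sub
    ((eulerIntegral.hasDerivAt (n + 1) n x).inv hP.ne')).div (hx'.const_sub 1) hne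
  refine (h.congr_deriv ?_).congr_of_eventuallyEq ?_
  · have e := inv_eulerIntegral n hx.le
    have e' : eulerLogDeriv n x = ((n : ℝ) + 1 + 1 + (n + 1) * x
        - (eulerIntegral (n + 1) (n + 1) x)⁻¹) / (1 - x) := by
      rw [e]; field_simp; ring
    simp only [derivative, e', Pi.sub_apply, Pi.inv_apply]
    field_simp
    ring
  · filter_upwards [Iio_mem_nhds hx] with y hy
    have hy' : 1 - y ≠ 0 := (sub_pos.2 hy).ne'
    simp only [Pi.sub_apply, Pi.inv_apply, Pi.div_apply]
    rw [inv_eulerIntegral n (le_of_lt hy)]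
    field_simp
    ring

theorem apply_zero (n : ℕ) : eulerLogDeriv n 0 = 0 := by simp [eulerLogDeriv]

theorem derivative_zero (n : ℕ) : derivative n 0 = ((n : ℝ) + 1) / (n + 1 + 2) := by
  simp only [derivative, apply_zero, eulerIntegral.apply_zero]
  push_cast
  have h1 : (n : ℝ) + 1 + 1 ≠ 0 := by positivity
  have h2 : (n : ℝ) + 2 + 1 ≠ 0 := by positivity
  have h3 : (n : ℝ) + 1 + 2 ≠ 0 := by positivity
  field_simp
  ring

theorem riccati (n : ℕ) {x : ℝ} (hx : x < 1) :
    x * (1 - x) * derivative n x = (n + 1) * x - eulerLogDeriv n x *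
      (n + 1 + 1 + (n + 1) * x - (1 - x) * eulerLogDeriv n x) + x * eulerLogDeriv n x := by
  have hne : 1 - x ≠ 0 := (sub_pos.2 hx).ne'
  rw [← inv_eulerIntegral n hx.le]
  simp only [derivative, eulerLogDeriv]
  have := (pos (n + 1) (n + 1) hx.le).ne'
  field_simp

theorem sub_comp_mul_le (n : ℕ) {x t : ℝ} (hx : x ∈ Set.Ioo (0 : ℝ) 1)
    (ht : t ∈ Set.Ico (0 : ℝ) 1) :
    eulerLogDeriv n t - eulerLogDeriv n (x * t) ≤ 1 / 2 - eulerLogDeriv n x := by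
  rw [← apply_one n]
  exact riccati_sub_comp_mul_le (by simp) (fun y hy => hasDerivAt n hy.2) (apply_zero n)
    (derivative_zero n) (fun y hy => riccati n hy.2) (continuousAt_one n) hx ht

theorem lt_half (n : ℕ) {x : ℝ} (hx : x ∈ Set.Ico (0 : ℝ) 1) : eulerLogDeriv n x < 1 / 2 := by
  have := riccati_le (m := n + 1) (by simp) (fun y hy => hasDerivAt n hy.2) (apply_zero n)
    (fun y hy => riccati n hy.2) x hx
  linarith [hx.2]

end eulerLogDeriv

theorem eulerIntegral_ratio_lt (n : ℕ) {x t : ℝ} (hx : x ∈ Set.Ioo (0 : ℝ) 1)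
    (ht : t ∈ Set.Ioo (0 : ℝ) 1) :
    eulerIntegral (n + 1) n x / eulerIntegral n (n + 1) x <
      eulerIntegral (n + 1) (n + 1) (x * t) / eulerIntegral n (n + 1) (x * t) *
        (eulerIntegral n (n + 1) t / eulerIntegral (n + 1) (n + 1) t) := by
  have hy : x * t < 1 := mul_lt_one_of_nonneg_of_lt_one_left hx.1.le hx.2 ht.2.le
  have hm : (n : ℝ) + 1 ≠ 0 := by positivity
  have ratio : ∀ z : ℝ, z ≤ 1 → eulerIntegral n (n + 1) z =
      (n + 1 + 1 - eulerLogDeriv n z) / (n + 1) * eulerIntegral (n + 1) (n + 1) z :=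
    fun z hz => by
      rw [div_mul_eq_mul_div, eq_div_iff hm, ← eulerLogDeriv.mul_left_integral n hz]; ring
  have ratio' : eulerIntegral (n + 1) n x =
      (n + 1 + eulerLogDeriv n x) / (n + 1) * eulerIntegral (n + 1) (n + 1) x := by
    rw [div_mul_eq_mul_div, eq_div_iff hm, ← eulerLogDeriv.mul_right_integral n hx.2.le]; ring
  rw [ratio', ratio x hx.2.le, ratio t ht.2.le, ratio (x * t) hy.le]
  have p1 := (eulerIntegral.pos (n + 1) (n + 1) hx.2.le).ne'
  have p2 := (eulerIntegral.pos (n + 1) (n + 1) ht.2.le).ne'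
  have p3 := (eulerIntegral.pos (n + 1) (n + 1) hy.le).ne'
  have ha := eulerLogDeriv.lt_half n ⟨ht.1.le, ht.2⟩
  have hb := eulerLogDeriv.lt_half n ⟨(mul_pos hx.1 ht.1).le, hy⟩
  have hc := eulerLogDeriv.lt_half n ⟨hx.1.le, hx.2⟩
  have hab := eulerLogDeriv.sub_comp_mul_le n hx ⟨ht.1.le, ht.2⟩
  have hc0 := riccati_nonneg (m := n + 1) (by simp) (fun y hy => eulerLogDeriv.hasDerivAt n hy.2)
    (eulerLogDeriv.apply_zero n) (eulerLogDeriv.derivative_zero n)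
    (fun y hy => eulerLogDeriv.riccati n hy.2) x ⟨hx.1.le, hx.2⟩
  set a := eulerLogDeriv n t
  set b := eulerLogDeriv n (x * t)
  set c := eulerLogDeriv n x
  have hn : (0 : ℝ) ≤ n := n.cast_nonneg
  have hb' : 0 < (n : ℝ) + 1 + 1 - b := by linarith
  have hc' : 0 < (n : ℝ) + 1 + 1 - c := by linarith
  have key : ((n : ℝ) + 1 + c) * (n + 1 + 1 - b) < (n + 1 + 1 - a) * (n + 1 + 1 - c) := by
    have h1 : ((n : ℝ) + 1 + c) * (a - b) ≤ (n + 1 + c) * (1 / 2 - c) :=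
      mul_le_mul_of_nonneg_left hab (by linarith)
    have h2 : 0 < (1 / 2 - c) * (n + 3 - 2 * a - c) :=
      mul_pos (by linarith) (by linarith)
    nlinarith
  have hR : ((n : ℝ) + 1 + c) / (n + 1 + 1 - c) < (n + 1 + 1 - a) / (n + 1 + 1 - b) := by
    rwa [div_lt_div_iff₀ hc' hb']
  convert hR using 1 <;> field_simp

theorem key_inequality (m : ℕ) (hm : 1 ≤ m) (s t : ℝ)
    (hs : 0 < s) (hst : s < t) (ht : t < 1) :
    ((∫ τ in (0:ℝ)..s, (s - τ)^m * (1 - τ)^m) /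
       (∫ τ in (0:ℝ)..s, (s - τ)^(m-1) * (1 - τ)^m)) *
    ((∫ τ in (0:ℝ)..t, (t - τ)^(m-1) * (1 - τ)^m) /
       (∫ τ in (0:ℝ)..t, (t - τ)^m * (1 - τ)^m)) >
    (∫ τ in (0:ℝ)..s, (s - τ)^m * (t - τ)^(m-1)) /
      (∫ τ in (0:ℝ)..s, (t - τ)^m * (s - τ)^(m-1)) := by
  obtain ⟨n, rfl⟩ := Nat.exists_eq_add_of_le' hm
  have ht0 : 0 < t := hs.trans hst
  have hxt : s = s / t * t := (div_mul_cancel₀ s ht0.ne').symm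
  have h := eulerIntegral_ratio_lt n (x := s / t) (t := t)
    ⟨div_pos hs ht0, (div_lt_one ht0).2 hst⟩ ⟨ht0, ht⟩
  rw [← hxt] at h
  have hcomm : ∫ τ in (0:ℝ)..s, (t - τ) ^ (n + 1) * (s - τ) ^ n =
      ∫ τ in (0:ℝ)..s, (s - τ) ^ n * (t - τ) ^ (n + 1) := by simp only [mul_comm]
  simp only [Nat.add_sub_cancel]
  rw [hcomm]
  simp only [eulerIntegral.integral_sub_pow_mul_sub_pow _ _ (mul_one s).symm,
    eulerIntegral.integral_sub_pow_mul_sub_pow _ _ (mul_one t).symm,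
    eulerIntegral.integral_sub_pow_mul_sub_pow _ _ hxt, one_pow, mul_one]
  refine lt_of_eq_of_lt ?_ ((mul_lt_mul_of_pos_left h (div_pos hs ht0)).trans_eq ?_)
  · field_simp
    ring
  · field_simp
    ring
end

section
/- Let Q : (0,1] → (0,∞) be differentiable and suppose the function F(y) = y·Q′(y)/Q(y) is strictly increasing on (0,1]. Then for every fixed k ∈ (0,1), the function t ↦ Q(kt)/Q(t) is strictly decreasing on (0,1]. Consequently, if an inequality of the form Q̂(s)/Q̂(t) > Q̂(s/t) − 1 (with Q̂(y) = (2m+1)Q(y)/y for a constant m) holds at t = 1 for all s ∈ (0,1), then it holds for all 0 < s < t < 1. -/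
/-- If the elasticity `y * Q' y / Q y` of a positive function `Q` is strictly increasing on `(0, 1]`,
then `t ↦ Q (k * t) / Q t` is strictly decreasing there for every `k ∈ (0, 1)`. -/
theorem strictAntiOn_div_of_strictMonoOn_elasticity {Q Q' : ℝ → ℝ}
    (hQpos : ∀ y ∈ Set.Ioc (0:ℝ) 1, 0 < Q y)
    (hderiv : ∀ y ∈ Set.Ioc (0:ℝ) 1, HasDerivAt Q (Q' y) y)
    (hF : StrictMonoOn (fun y => y * Q' y / Q y) (Set.Ioc (0:ℝ) 1))
    {k : ℝ} (hk : k ∈ Set.Ioo (0:ℝ) 1) :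
    StrictAntiOn (fun t => Q (k * t) / Q t) (Set.Ioc (0:ℝ) 1) := by
  have hmem : ∀ t ∈ Set.Ioc (0:ℝ) 1, k * t ∈ Set.Ioc (0:ℝ) 1 := fun t ht =>
    ⟨mul_pos hk.1 ht.1, mul_le_one₀ hk.2.le ht.1.le ht.2⟩
  have hd : ∀ t ∈ Set.Ioc (0:ℝ) 1, HasDerivAt (fun t => Q (k * t) / Q t)
      ((Q' (k * t) * k * Q t - Q (k * t) * Q' t) / Q t ^ 2) t := by
    intro t ht
    have hmul : HasDerivAt (fun t => k * t) k t := by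
      simpa using (hasDerivAt_id t).const_mul k
    exact ((hderiv _ (hmem t ht)).comp t hmul).div (hderiv t ht) (hQpos t ht).ne'
  refine strictAntiOn_of_deriv_neg (convex_Ioc 0 1)
    (fun t ht => (hd t ht).continuousAt.continuousWithinAt) fun t ht => ?_
  replace ht := interior_subset ht
  rw [(hd t ht).deriv]
  have hpos := hQpos t ht
  refine div_neg_of_neg_of_pos ?_ (pow_pos hpos 2)
  have hlt : k * t * Q' (k * t) / Q (k * t) < t * Q' t / Q t :=
    hF (hmem t ht) ht (mul_lt_of_lt_one_left ht.1 hk.2)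
  rw [div_lt_div_iff₀ (hQpos _ (hmem t ht)) hpos] at hlt
  refine neg_of_mul_neg_right (a := t) ?_ ht.1.le
  linarith


theorem reduce_to_t_eq_one (Q Q' : ℝ → ℝ)
    (hQpos : ∀ y ∈ Set.Ioc (0:ℝ) 1, 0 < Q y)
    (hderiv : ∀ y ∈ Set.Ioc (0:ℝ) 1, HasDerivAt Q (Q' y) y)
    (hF : StrictMonoOn (fun y => y * Q' y / Q y) (Set.Ioc (0:ℝ) 1)) :
    (∀ k ∈ Set.Ioo (0:ℝ) 1,
      StrictAntiOn (fun t => Q (k*t) / Q t) (Set.Ioc (0:ℝ) 1)) ∧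
    (∀ (c : ℝ) (Qh : ℝ → ℝ), (∀ y, Qh y = c * Q y / y) →
      (∀ s ∈ Set.Ioo (0:ℝ) 1, Qh s / Qh 1 > Qh (s/1) - 1) →
      ∀ s t : ℝ, 0 < s → s < t → t < 1 → Qh s / Qh t > Qh (s/t) - 1) := by
  have hanti := fun k (hk : k ∈ Set.Ioo (0:ℝ) 1) =>
    strictAntiOn_div_of_strictMonoOn_elasticity hQpos hderiv hF hk
  refine ⟨hanti, fun c Qh hQh h s t hs hst ht => ?_⟩
  have ht0 : 0 < t := hs.trans hst
  rcases eq_or_ne c 0 with rfl | hc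
  · simp [hQh]
  have hk : s / t ∈ Set.Ioo (0:ℝ) 1 := ⟨div_pos hs ht0, (div_lt_one ht0).2 hst⟩
  have hlt : Q (s / t * 1) / Q 1 < Q (s / t * t) / Q t :=
    hanti _ hk ⟨ht0, ht.le⟩ ⟨one_pos, le_rfl⟩ ht
  rw [mul_one, div_mul_cancel₀ s ht0.ne'] at hlt
  have hQt := (hQpos t ⟨ht0, ht.le⟩).ne'
  have hQ1 := (hQpos 1 ⟨one_pos, le_rfl⟩).ne'
  have h₁ : Qh s / Qh t = Q s / Q t / (s / t) := by
    rw [hQh, hQh]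
    field_simp
  have h₂ : Qh (s / t) / Qh 1 = Q (s / t) / Q 1 / (s / t) := by
    rw [hQh, hQh]
    field_simp
  have hone := h _ hk
  rw [div_one (s / t), h₂] at hone
  rw [h₁]
  exact hone.trans (div_lt_div_of_pos_right hlt hk.1)
end
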